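/- Let (R, 𝔪) be an excellent Noetherian local domain of prime characteristic p > 0 with residue field k = R/𝔪. If Tor_1^R(R^+, k) = 0, then Tor_n^R(R^+, k) = 0 for all n ≥ 1; that is, the vanishing of the first Betti number of R^+ implies the vanishing of all Betti numbers of R^+. -/

import Mathlib

set_option synthInstance.maxHeartbeats 1000000
set_option maxHeartbeats 1000000
set_option linter.unusedVariables false

open CategoryTheory

/-- `Tor_n^R(M, N)`, the `n`-th Tor group of the `R`-modules `M` and `N`. -/
noncomputable abbrev TorGrp (R : Type) [CommRing R] (n : ℕ)
    (M N : Type) [AddCommGroup M] [Module R M] [AddCommGroup N] [Module R N] : Type :=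
  ((Tor (ModuleCat R) n).obj (ModuleCat.of R M)).obj (ModuleCat.of R N)

/-- The absolute integral closure `R⁺` of a domain `R`: the integral closure of `R`
in an algebraic closure of its fraction field. -/
noncomputable abbrev AbsIntClo (R : Type) [CommRing R] [IsDomain R] : Type :=
  integralClosure R (AlgebraicClosure (FractionRing R))

/-- A regular local ring: a Noetherian local ring whose maximal ideal can be generated
by Krull-dimension many elements. -/
def IsRegularLocalRingP (A : Type) [CommRing A] : Prop :=
  IsNoetherianRing A ∧ ∃ h : IsLocalRing A, ∃ s : Finset A,
    Ideal.span (s : Set A) = @IsLocalRing.maximalIdeal A _ h ∧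
      (s.card : WithBot ℕ∞) = ringKrullDim A

/-- A regular ring: a Noetherian ring all of whose localizations at primes are
regular local rings. -/
def IsRegularRingP (A : Type) [CommRing A] : Prop :=
  IsNoetherianRing A ∧
    ∀ (p : Ideal A) (hp : p.IsPrime),
      haveI := hp
      IsRegularLocalRingP (Localization.AtPrime p)

/-- A chain of primes is saturated if each step is a covering relation. -/
def IsSaturatedChain {α : Type} [Preorder α] (c : LTSeries α) : Prop :=
  ∀ i : Fin c.length, c.toFun i.castSucc ⋖ c.toFun i.succ

/-- A ring is catenary if any two saturated chains of primes with the same endpoints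
have the same length. -/
def IsCatenaryRing (A : Type) [CommRing A] : Prop :=
  ∀ c₁ c₂ : LTSeries (PrimeSpectrum A),
    c₁.head = c₂.head → c₁.last = c₂.last →
      IsSaturatedChain c₁ → IsSaturatedChain c₂ → c₁.length = c₂.length

/-- A ring is universally catenary if every finitely generated algebra over it
(i.e. every quotient of a polynomial ring over it) is catenary. -/
def IsUniversallyCatenary (A : Type) [CommRing A] : Prop :=
  ∀ (n : ℕ) (I : Ideal (MvPolynomial (Fin n) A)),
    IsCatenaryRing (MvPolynomial (Fin n) A ⧸ I)

/-- A `κ`-algebra `B` is geometrically regular if `L ⊗_κ B` is a regular ring for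
every finite field extension `L` of `κ`. -/
def IsGeometricallyRegularAlgebra (κ : Type) [Field κ] (B : Type) [CommRing B]
    [Algebra κ B] : Prop :=
  ∀ (L : Type) (_ : Field L) (_ : Algebra κ L) (_ : Module.Finite κ L),
    IsRegularRingP (TensorProduct κ L B)

/-- A ring `A` is a G-ring if for every prime `p` of `A`, all fibers of the completion
map `A_p → (A_p)^∧` are geometrically regular; the fiber at a prime `q` of `A_p` is
`κ(q) ⊗_{A_p} (A_p)^∧`. -/
def IsGRing (A : Type) [CommRing A] : Prop :=
  ∀ (p : Ideal A) (hp : p.IsPrime),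
    haveI := hp
    ∀ (q : Ideal (Localization.AtPrime p)) (hq : q.IsPrime),
      haveI := hq
      IsGeometricallyRegularAlgebra
        (IsLocalRing.ResidueField (Localization.AtPrime q))
        (TensorProduct (Localization.AtPrime p)
          (IsLocalRing.ResidueField (Localization.AtPrime q))
          (AdicCompletion (IsLocalRing.maximalIdeal (Localization.AtPrime p))
            (Localization.AtPrime p)))

/-- A ring `A` is J-2 if the regular locus of every finitely generated `A`-algebra
is open in its prime spectrum. -/
def IsJ2 (A : Type) [CommRing A] : Prop :=
  ∀ (n : ℕ) (I : Ideal (MvPolynomial (Fin n) A)),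
    IsOpen {p : PrimeSpectrum (MvPolynomial (Fin n) A ⧸ I) |
      IsRegularLocalRingP (Localization.AtPrime p.asIdeal)}

/-- A ring is excellent if it is Noetherian, universally catenary, a G-ring, and J-2. -/
def IsExcellentRing (A : Type) [CommRing A] : Prop :=
  IsNoetherianRing A ∧ IsUniversallyCatenary A ∧ IsGRing A ∧ IsJ2 A

/-- A list of elements of a local ring is a system of parameters if its elements lie in
the maximal ideal, its length is the Krull dimension, and the ideal it generates has
radical the maximal ideal (i.e. is primary to the maximal ideal). -/
def IsSystemOfParameters (R : Type) [CommRing R] [IsLocalRing R] (rs : List R) : Prop :=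
  (∀ x ∈ rs, x ∈ IsLocalRing.maximalIdeal R) ∧
    (rs.length : WithBot ℕ∞) = ringKrullDim R ∧
    (Ideal.ofList rs).radical = IsLocalRing.maximalIdeal R

/-- A local ring is Cohen-Macaulay if it is Noetherian and admits a regular sequence of
length equal to its Krull dimension consisting of elements of the maximal ideal. -/
def IsCohenMacaulayLocalRing (R : Type) [CommRing R] : Prop :=
  IsNoetherianRing R ∧ ∃ h : IsLocalRing R,
    ∃ rs : List R, (∀ x ∈ rs, x ∈ @IsLocalRing.maximalIdeal R _ h) ∧
      RingTheory.Sequence.IsRegular R rs ∧ (rs.length : WithBot ℕ∞) = ringKrullDim R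

/-- An `R`-algebra `S` is a big Cohen-Macaulay `R`-algebra if some system of parameters
of `R` is an `S`-regular sequence. -/
def IsBigCohenMacaulayAlgebra (R : Type) [CommRing R] [IsLocalRing R]
    (S : Type) [CommRing S] [Algebra R S] : Prop :=
  ∃ rs : List R, IsSystemOfParameters R rs ∧ RingTheory.Sequence.IsRegular S rs

/-- Lech independence of a finite family: the coefficients of every linear relation among the
members of the family lie in the ideal they generate. -/
def LechIndependent {R ι : Type*} [CommRing R] [Fintype ι] (f : ι → R) : Prop :=
  ∀ a : ι → R, ∑ j, a j * f j = 0 → ∀ j, a j ∈ Ideal.span (Set.range f)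

namespace LechIndependent

variable {R ι : Type*} [CommRing R] [Fintype ι] [DecidableEq ι]

private lemma sum_update_mul (f a : ι → R) (i : ι) (g : R) :
    ∑ j, a j * Function.update f i g j = a i * g + ∑ j ∈ Finset.univ.erase i, a j * f j := by
  rw [← Finset.add_sum_erase _ _ (Finset.mem_univ i)]
  simp only [Function.update_self]
  congr 1
  refine Finset.sum_congr rfl fun j hj => ?_
  rw [Function.update_of_ne (Finset.ne_of_mem_erase hj)]

private lemma mem_span_update (f : ι → R) (i : ι) (g a : R) :
    a ∈ Ideal.span (Set.range (Function.update f i g)) ↔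
      ∃ b : ι → R, a = b i * g + ∑ j ∈ Finset.univ.erase i, b j * f j := by
  rw [Ideal.mem_span_range_iff_exists_fun]
  simp only [sum_update_mul, eq_comm]

private lemma span_update_mul_le (f : ι → R) (i : ι) (g h : R) :
    Ideal.span (Set.range (Function.update f i (g * h))) ≤
      Ideal.span (Set.range (Function.update f i g)) := by
  intro a ha
  rw [mem_span_update] at ha ⊢
  obtain ⟨b, rfl⟩ := ha
  refine ⟨Function.update b i (b i * h), ?_⟩
  rw [Function.update_self]
  congr 1
  · ring
  · refine Finset.sum_congr rfl fun j hj => ?_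
    rw [Function.update_of_ne (Finset.ne_of_mem_erase hj)]

/-- Replacing one member of a Lech independent family by a divisor preserves Lech independence. -/
lemma of_update_mul {f : ι → R} {i : ι} {g h : R}
    (H : LechIndependent (Function.update f i (g * h))) :
    LechIndependent (Function.update f i g) := by
  intro a ha
  rw [sum_update_mul] at ha
  have h1 := H (Function.update (fun j => h * a j) i (a i)) (by
    rw [sum_update_mul, Function.update_self]
    have : ∑ j ∈ Finset.univ.erase i, Function.update (fun j => h * a j) i (a i) j * f j =
        h * ∑ j ∈ Finset.univ.erase i, a j * f j := by
      rw [Finset.mul_sum]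
      refine Finset.sum_congr rfl fun j hj => ?_
      rw [Function.update_of_ne (Finset.ne_of_mem_erase hj)]
      ring
    rw [this]
    linear_combination h * ha) i
  rw [Function.update_self] at h1
  have h1' := span_update_mul_le f i g h h1
  obtain ⟨b, hb⟩ := (mem_span_update _ _ _ _).1 h1
  have h2 := H (Function.update (fun j => a j + b j * g) i (b i * g)) (by
    rw [sum_update_mul, Function.update_self]
    have : ∑ j ∈ Finset.univ.erase i,
        Function.update (fun j => a j + b j * g) i (b i * g) j * f j =
        ∑ j ∈ Finset.univ.erase i, a j * f j + g * ∑ j ∈ Finset.univ.erase i, b j * f j := by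
      rw [Finset.mul_sum, ← Finset.sum_add_distrib]
      refine Finset.sum_congr rfl fun j hj => ?_
      rw [Function.update_of_ne (Finset.ne_of_mem_erase hj)]
      ring
    rw [this]
    linear_combination ha - g * hb)
  intro j
  by_cases hj : j = i
  · rw [hj]; exact h1'
  · have h3 := h2 j
    rw [Function.update_of_ne hj] at h3
    have h4 := span_update_mul_le f i g h h3
    have h5 : b j * g ∈ Ideal.span (Set.range (Function.update f i g)) :=
      Ideal.mul_mem_left _ _ (Ideal.subset_span ⟨i, by simp⟩)
    simpa using Ideal.sub_mem _ h4 h5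

lemma mem_span_of_mul_mem {f : ι → R} {i : ι} {g h a : R}
    (H : LechIndependent (Function.update f i (g * h)))
    (ha : h * a ∈ Ideal.span (Set.range (Function.update f i (g * h)))) :
    a ∈ Ideal.span (Set.range (Function.update f i g)) := by
  obtain ⟨b, hb⟩ := (mem_span_update _ _ _ _).1 ha
  have h1 := H (Function.update (fun j => - (g * b j)) i (a - g * b i)) (by
    rw [sum_update_mul, Function.update_self]
    have : ∑ j ∈ Finset.univ.erase i,
        Function.update (fun j => - (g * b j)) i (a - g * b i) j * f j =
        - (g * ∑ j ∈ Finset.univ.erase i, b j * f j) := by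
      rw [Finset.mul_sum, ← Finset.sum_neg_distrib]
      refine Finset.sum_congr rfl fun j hj => ?_
      rw [Function.update_of_ne (Finset.ne_of_mem_erase hj)]
      ring
    rw [this]
    linear_combination g * hb) i
  rw [Function.update_self] at h1
  have h2 := span_update_mul_le f i g h h1
  have h3 : b i * g ∈ Ideal.span (Set.range (Function.update f i g)) :=
    Ideal.mul_mem_left _ _ (Ideal.subset_span ⟨i, by simp⟩)
  have := Ideal.add_mem _ h2 h3
  rwa [show a - g * b i + b i * g = a by ring] at this

/-- Lech independence of high powers passes to all smaller powers. -/
lemma pow_of_le {x : ι → R} {q : ℕ} (H : LechIndependent fun j => x j ^ q) {e : ι → ℕ}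
    (he : ∀ j, e j ≤ q) : LechIndependent fun j => x j ^ e j := by
  have key : ∀ s : Finset ι, LechIndependent fun j => if j ∈ s then x j ^ e j else x j ^ q := by
    intro s
    induction s using Finset.induction_on with
    | empty => simpa using H
    | insert i s hi ih =>
      have h1 : (fun j => if j ∈ insert i s then x j ^ e j else x j ^ q) =
          Function.update (fun j => if j ∈ s then x j ^ e j else x j ^ q) i (x i ^ e i) := by
        funext j
        by_cases hj : j = i
        · subst hj; simp
        · simp [hj]
      have h2 : (fun j => if j ∈ s then x j ^ e j else x j ^ q) =
          Function.update (fun j => if j ∈ s then x j ^ e j else x j ^ q) i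
            (x i ^ e i * x i ^ (q - e i)) := by
        rw [← pow_add, Nat.add_sub_cancel' (he i)]
        funext j
        by_cases hj : j = i
        · subst hj; simp [hi]
        · simp [hj]
      rw [h1]
      rw [h2] at ih
      exact ih.of_update_mul
  simpa using key Finset.univ

/-- Colon ideals of powers of a family whose high powers are Lech independent. -/
lemma mem_span_pow_of_mul_mem {x : ι → R} (H : ∀ n, ∃ q, n ≤ q ∧ LechIndependent fun j => x j ^ q)
    (e : ι → ℕ) (l : ι) (s : ℕ) (hs : s ≤ e l) {a : R}
    (ha : x l ^ s * a ∈ Ideal.span (Set.range fun j => x j ^ e j)) :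
    a ∈ Ideal.span (Set.range fun j => x j ^ Function.update e l (e l - s) j) := by
  obtain ⟨q, hq, hL⟩ := H (∑ j, e j)
  have h1 : LechIndependent fun j => x j ^ e j :=
    hL.pow_of_le fun j => (Finset.single_le_sum (fun _ _ => Nat.zero_le _)
      (Finset.mem_univ j)).trans hq
  have h2 : (fun j => x j ^ e j) =
      Function.update (fun j => x j ^ e j) l (x l ^ (e l - s) * x l ^ s) := by
    rw [← pow_add, Nat.sub_add_cancel hs]
    simp
  have h3 : (fun j => x j ^ Function.update e l (e l - s) j) =
      Function.update (fun j => x j ^ e j) l (x l ^ (e l - s)) := by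
    funext j
    by_cases hj : j = l
    · subst hj; simp
    · simp [hj]
  rw [h3]
  rw [h2] at h1 ha
  exact h1.mem_span_of_mul_mem ha

end LechIndependent

/-- Krull's intersection theorem for ideals of a Noetherian local ring. -/
lemma IsLocalRing.mem_of_forall_mem_sup_pow {R : Type*} [CommRing R] [IsNoetherianRing R]
    [IsLocalRing R] {M : Type*} [AddCommGroup M] [Module R M] [Module.Finite R M]
    (W : Submodule R M) (a : M)
    (h : ∀ n : ℕ, a ∈ W ⊔ (maximalIdeal R ^ n • ⊤ : Submodule R M)) : a ∈ W := by
  have h1 := Ideal.iInf_pow_smul_eq_bot_of_isLocalRing (M := M ⧸ W) (maximalIdeal R)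
    (Ideal.IsPrime.ne_top inferInstance)
  rw [← Submodule.Quotient.mk_eq_zero, ← Submodule.mem_bot R, ← h1, Submodule.mem_iInf]
  intro n
  obtain ⟨w, hw, z, hz, rfl⟩ := Submodule.mem_sup.1 (h n)
  rw [Submodule.Quotient.mk_add, (Submodule.Quotient.mk_eq_zero W).2 hw, zero_add]
  have h2 := Submodule.mem_map_of_mem (f := W.mkQ) hz
  rw [Submodule.map_smul''] at h2
  exact Submodule.smul_mono le_rfl le_top h2

/-- A family of elements of the maximal ideal with arbitrarily high Lech independent powers is a
permutable regular sequence, and so are its powers. -/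
lemma LechIndependent.colon_subfamily {R ι : Type*} [CommRing R] [IsNoetherianRing R]
    [IsLocalRing R] [Fintype ι] {x : ι → R} (hx : ∀ j, x j ∈ IsLocalRing.maximalIdeal R)
    (H : ∀ n, ∃ q, n ≤ q ∧ LechIndependent fun j => x j ^ q)
    (J : Finset ι) (l : ι) (hl : l ∉ J) (e : ι → ℕ) (s : ℕ) (a : R) (w : ι → R)
    (ha : x l ^ s * a = ∑ j ∈ J, x j ^ e j * w j) :
    ∃ w' : ι → R, a = ∑ j ∈ J, x j ^ e j * w' j := by
  classical
  have key : a ∈ Ideal.span ((fun j => x j ^ e j) '' (J : Set ι)) := by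
    refine IsLocalRing.mem_of_forall_mem_sup_pow (R := R) (M := R) _ a fun n => ?_
    let E : ι → ℕ := fun j => if j ∈ J then e j else if j = l then n + s else n
    have h1 : x l ^ s * a ∈ Ideal.span (Set.range fun j => x j ^ E j) := by
      rw [ha]
      refine Ideal.sum_mem _ fun j hj => Ideal.mul_mem_right _ _ (Ideal.subset_span ⟨j, ?_⟩)
      simp [E, hj]
    have hEl : E l = n + s := by simp [E, hl]
    have h2 := LechIndependent.mem_span_pow_of_mul_mem H E l s (by omega) h1
    refine (?_ : Ideal.span _ ≤ _) h2
    rw [Ideal.span_le]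
    rintro _ ⟨j, rfl⟩
    by_cases hj : j ∈ J
    · refine Submodule.mem_sup_left (Ideal.subset_span ⟨j, hj, ?_⟩)
      have : j ≠ l := fun h => hl (h ▸ hj)
      simp [this, E, hj]
    · refine Submodule.mem_sup_right ?_
      have : Function.update E l (E l - s) j = n := by
        by_cases h : j = l
        · subst h; simp [hEl]
        · simp [h, E, hj]
      simp only [this, smul_eq_mul, Ideal.mul_top]
      exact Ideal.pow_mem_pow (hx j) n
  obtain ⟨c, hc⟩ := (Submodule.mem_span_image_finset_iff_exists_fun R).1 key
  refine ⟨fun j => if h : j ∈ J then c ⟨j, h⟩ else 0, ?_⟩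
  rw [← hc, ← Finset.sum_coe_sort J]
  refine Finset.sum_congr rfl fun j _ => ?_
  simp [mul_comm]

/-- A family of elements of `Ω` is boundedly integral over `R` if its members lie in a common
finitely generated `R`-submodule of the integral closure of `R` in `Ω`. -/
def BoundedlyIntegral (R : Type*) {Ω κ : Type*} [CommRing R] [Field Ω] [Algebra R Ω]
    (u : κ → Ω) : Prop :=
  ∃ T : Submodule R Ω, T.FG ∧ T ≤ Subalgebra.toSubmodule (integralClosure R Ω) ∧ ∀ i, u i ∈ T

namespace BoundedlyIntegral

variable {R Ω κ : Type*} [CommRing R] [Field Ω] [Algebra R Ω]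

lemma zero : BoundedlyIntegral R (fun _ : κ => (0 : Ω)) :=
  ⟨⊥, Submodule.fg_bot, bot_le, fun _ => Submodule.zero_mem _⟩

lemma add {u v : κ → Ω} (hu : BoundedlyIntegral R u) (hv : BoundedlyIntegral R v) :
    BoundedlyIntegral R fun i => u i + v i := by
  obtain ⟨T, hT, hT', hu⟩ := hu
  obtain ⟨U, hU, hU', hv⟩ := hv
  exact ⟨T ⊔ U, hT.sup hU, sup_le hT' hU', fun i =>
    add_mem (Submodule.mem_sup_left (hu i)) (Submodule.mem_sup_right (hv i))⟩

lemma smul {u : κ → Ω} (r : κ → R) (hu : BoundedlyIntegral R u) :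
    BoundedlyIntegral R fun i => r i • u i := by
  obtain ⟨T, hT, hT', hu⟩ := hu
  exact ⟨T, hT, hT', fun i => T.smul_mem _ (hu i)⟩

lemma sub {u v : κ → Ω} (hu : BoundedlyIntegral R u) (hv : BoundedlyIntegral R v) :
    BoundedlyIntegral R fun i => u i - v i := by
  simpa [sub_eq_add_neg] using hu.add (hv.smul fun _ => (-1 : R))

lemma sum {σ : Type*} {s : Finset σ} {u : σ → κ → Ω}
    (hu : ∀ j ∈ s, BoundedlyIntegral R (u j)) :
    BoundedlyIntegral R fun i => ∑ j ∈ s, u j i := by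
  classical
  induction s using Finset.induction_on with
  | empty => simpa using zero
  | insert j s hj ih =>
    simp only [Finset.sum_insert hj]
    exact (hu j (Finset.mem_insert_self _ _)).add
      (ih fun k hk => hu k (Finset.mem_insert_of_mem hk))

lemma comp {κ' : Type*} {u : κ → Ω} (hu : BoundedlyIntegral R u) (g : κ' → κ) :
    BoundedlyIntegral R fun i => u (g i) := by
  obtain ⟨T, hT, hT', hu⟩ := hu
  exact ⟨T, hT, hT', fun i => hu _⟩

lemma mem {u : κ → Ω} (hu : BoundedlyIntegral R u) (i : κ) : u i ∈ integralClosure R Ω := by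
  obtain ⟨T, -, hT', hu⟩ := hu
  exact hT' (hu i)

lemma const {b : Ω} (hb : b ∈ integralClosure R Ω) :
    BoundedlyIntegral R fun _ : κ => b :=
  ⟨R ∙ b, Submodule.fg_span_singleton b, by
    rw [Submodule.span_singleton_le_iff_mem]; exact hb,
    fun _ => Submodule.mem_span_singleton_self b⟩

/-- Finitely generated submodules of the integral closure are contained in finite subalgebras. -/
lemma exists_subalgebra {T : Submodule R Ω} (hT : T.FG)
    (hT' : T ≤ Subalgebra.toSubmodule (integralClosure R Ω)) :
    ∃ S : Subalgebra R Ω, T ≤ Subalgebra.toSubmodule S ∧ (Subalgebra.toSubmodule S).FG ∧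
      S ≤ integralClosure R Ω := by
  obtain ⟨s, rfl⟩ := hT
  have hs : ∀ b ∈ s, IsIntegral R b := fun b hb => hT' (Submodule.subset_span hb)
  refine ⟨Algebra.adjoin R s, ?_, ?_, ?_⟩
  · rw [Submodule.span_le]
    exact Algebra.subset_adjoin
  · exact fg_adjoin_of_finite s.finite_toSet hs
  · exact Algebra.adjoin_le hs

end BoundedlyIntegral

/-- The family `u` is a combination of the powers `x j ^ e j`, `j ∈ J`, with boundedly integral
coefficients. -/
def BoundedCombination {R Ω σ κ : Type*} [CommRing R] [Field Ω] [Algebra R Ω] (x : σ → R)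
    (J : Finset σ) (e : σ → κ → ℕ) (u : κ → Ω) : Prop :=
  ∃ w : σ → κ → Ω, (∀ j, BoundedlyIntegral R (w j)) ∧ ∀ i, u i = ∑ j ∈ J, x j ^ e j i • w j i

namespace BoundedCombination

variable {R Ω σ κ : Type*} [CommRing R] [Field Ω] [Algebra R Ω] {x : σ → R} {J : Finset σ}
  {e e' : σ → κ → ℕ} {u v : κ → Ω}

lemma add (hu : BoundedCombination x J e u) (hv : BoundedCombination x J e v) :
    BoundedCombination x J e fun i => u i + v i := by
  obtain ⟨w, hw, hu⟩ := hu
  obtain ⟨w', hw', hv⟩ := hv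
  refine ⟨fun j i => w j i + w' j i, fun j => (hw j).add (hw' j), fun i => ?_⟩
  simp only [hu, hv, smul_add, Finset.sum_add_distrib]

lemma smul (r : κ → R) (hu : BoundedCombination x J e u) :
    BoundedCombination x J e fun i => r i • u i := by
  obtain ⟨w, hw, hu⟩ := hu
  refine ⟨fun j i => r i • w j i, fun j => (hw j).smul r, fun i => ?_⟩
  simp only [hu, Finset.smul_sum, smul_comm (r i)]

lemma sub (hu : BoundedCombination x J e u) (hv : BoundedCombination x J e v) :
    BoundedCombination x J e fun i => u i - v i := by
  simpa [sub_eq_add_neg] using hu.add (hv.smul fun _ => (-1 : R))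

lemma congr_exponents (hu : BoundedCombination x J e u) (h : ∀ j ∈ J, e j = e' j) :
    BoundedCombination x J e' u := by
  obtain ⟨w, hw, hu⟩ := hu
  refine ⟨w, hw, fun i => ?_⟩
  rw [hu]
  exact Finset.sum_congr rfl fun j hj => by rw [h j hj]

lemma single {j : σ} (hj : j ∈ J) {w : κ → Ω} (hw : BoundedlyIntegral R w) :
    BoundedCombination x J e fun i => x j ^ e j i • w i := by
  classical
  refine ⟨fun k => if k = j then w else fun _ => 0, fun k => ?_, fun i => ?_⟩
  · dsimp only
    split_ifs
    exacts [hw, .zero]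
  · rw [Finset.sum_eq_single j]
    · simp
    · intro k _ hk; simp [hk]
    · exact fun h => absurd hj h

lemma zero : BoundedCombination x J e fun _ => (0 : Ω) :=
  ⟨fun _ _ => 0, fun _ => .zero, fun i => by simp⟩

lemma sum {τ : Type*} {s : Finset τ} {u : τ → κ → Ω}
    (hu : ∀ j ∈ s, BoundedCombination x J e (u j)) :
    BoundedCombination x J e fun i => ∑ j ∈ s, u j i := by
  classical
  induction s using Finset.induction_on with
  | empty => simpa using zero
  | insert j s hj ih =>
    simp only [Finset.sum_insert hj]
    exact (hu j (Finset.mem_insert_self _ _)).add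
      (ih fun k hk => hu k (Finset.mem_insert_of_mem hk))

lemma prod_pow_smul (hu : BoundedCombination x J e u) (f : σ → κ → ℕ) :
    BoundedCombination x J (fun j i => e j i + f j i)
      fun i => (∏ j ∈ J, x j ^ f j i) • u i := by
  classical
  obtain ⟨w, hw, hu⟩ := hu
  refine ⟨fun j i => (∏ k ∈ J.erase j, x k ^ f k i) • w j i, fun j => (hw j).smul _, fun i => ?_⟩
  simp only [hu, Finset.smul_sum]
  refine Finset.sum_congr rfl fun j hj => ?_
  rw [← Finset.mul_prod_erase J _ hj, smul_smul, smul_smul, pow_add]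
  congr 1
  ring

end BoundedCombination

/-- The powers of `x l`, `l ∉ J`, act injectively modulo powers of the `x j`, `j ∈ J`, uniformly in
boundedly integral families. -/
def UniformColon {R σ : Type*} (Ω : Type*) [CommRing R] [Field Ω] [Algebra R Ω] (x : σ → R)
    (J : Finset σ) : Prop :=
  ∀ (κ : Type) (e : σ → κ → ℕ) (l : σ) (_ : l ∉ J) (f : κ → ℕ) (u : κ → Ω),
    BoundedlyIntegral R u → BoundedCombination x J e (fun i => x l ^ f i • u i) →
      BoundedCombination x J e u

namespace UniformColon

variable {R Ω σ : Type*} {κ : Type} [CommRing R] [Field Ω] [Algebra R Ω] {x : σ → R}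
  {J : Finset σ} {e f : σ → κ → ℕ} {u : κ → Ω}

lemma cancel_pow [DecidableEq σ] (H : ∀ J' : Finset σ, J'.card < J.card → UniformColon Ω x J')
    {l : σ} (hl : l ∈ J) {f : κ → ℕ} (hf : ∀ i, f i ≤ e l i) (hb : BoundedlyIntegral R u)
    (hu : BoundedCombination x J e fun i => x l ^ f i • u i) :
    BoundedCombination x J (Function.update e l fun i => e l i - f i) u := by
  obtain ⟨w, hw, hu⟩ := hu
  have h1 : BoundedCombination x (J.erase l) e fun i => u i - x l ^ (e l i - f i) • w l i := by
    refine H (J.erase l) (Finset.card_erase_lt_of_mem hl) κ e l (Finset.notMem_erase l J) f _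
      (hb.sub ((hw l).smul _)) ⟨w, hw, fun i => ?_⟩
    dsimp only at hu ⊢
    rw [smul_sub, hu, ← Finset.add_sum_erase _ _ hl, smul_smul, ← pow_add,
      Nat.add_sub_cancel' (hf i), add_sub_cancel_left]
  obtain ⟨w', hw', h1⟩ := h1
  refine ⟨Function.update w' l (w l), fun j => ?_, fun i => ?_⟩
  · by_cases hj : j = l
    · subst hj; simpa using hw j
    · simpa [hj] using hw' j
  · rw [← Finset.add_sum_erase _ _ hl, ← sub_eq_iff_eq_add']
    simp only [Function.update_self]
    dsimp only at h1
    rw [h1]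
    refine Finset.sum_congr rfl fun j hj => ?_
    rw [Function.update_of_ne (Finset.ne_of_mem_erase hj),
      Function.update_of_ne (Finset.ne_of_mem_erase hj)]

lemma cancel_prod_pow [DecidableEq σ]
    (H : ∀ J' : Finset σ, J'.card < J.card → UniformColon Ω x J')
    {K : Finset σ} (hK : K ⊆ J) (hf : ∀ j ∈ K, ∀ i, f j i ≤ e j i) (hb : BoundedlyIntegral R u)
    (hu : BoundedCombination x J e fun i => (∏ j ∈ K, x j ^ f j i) • u i) :
    BoundedCombination x J (fun j i => if j ∈ K then e j i - f j i else e j i) u := by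
  induction K using Finset.induction_on generalizing u with
  | empty => simpa using hu
  | insert k K hk ih =>
    have h1 := ih ((Finset.subset_insert k K).trans hK)
      (fun j hj => hf j (Finset.mem_insert_of_mem hj)) (hb.smul fun i => x k ^ f k i) (by
        simpa only [Finset.prod_insert hk, smul_smul, mul_comm] using hu)
    have h2 := cancel_pow H (hK (Finset.mem_insert_self k K)) (f := f k) (by
      simpa [hk] using hf k (Finset.mem_insert_self k K)) hb h1
    refine h2.congr_exponents fun j _ => ?_
    by_cases hj : j = k
    · subst hj; funext i; simp [hk]
    · funext i; simp [hj]

/-- If every `x j ^ N` multiplies `a` into the span of the `x j ^ e j`, then modulo that span `a` is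
a multiple of the product of the `x j ^ (e j - N)`. -/
lemma exists_sub_prod_pow_smul [DecidableEq σ]
    (H : ∀ J' : Finset σ, J'.card < J.card → UniformColon Ω x J') {N : ℕ}
    (hN : ∀ j i, N ≤ e j i) {a : κ → Ω} (hb : BoundedlyIntegral R a)
    (ha : ∀ j ∈ J, BoundedCombination x J e fun i => x j ^ N • a i) {K : Finset σ} (hK : K ⊆ J) :
    ∃ c : κ → Ω, BoundedlyIntegral R c ∧
      BoundedCombination x J e fun i => a i - (∏ j ∈ K, x j ^ (e j i - N)) • c i := by
  induction K using Finset.induction_on with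
  | empty => exact ⟨a, hb, by simpa using BoundedCombination.zero⟩
  | insert k K hk ih =>
    obtain ⟨c, hcb, hc⟩ := ih ((Finset.subset_insert k K).trans hK)
    have hkJ := hK (Finset.mem_insert_self k K)
    have h1 := (ha k hkJ).sub (hc.smul fun i => x k ^ N)
    have h2 : BoundedCombination x J e fun i =>
        (∏ j ∈ insert k K, x j ^ (if j = k then N else e j i - N)) • c i := by
      convert h1 using 2 with i
      rw [Finset.prod_insert hk, smul_sub, sub_sub_cancel, smul_smul]
      congr 2
      · simp
      · refine Finset.prod_congr rfl fun j hj => ?_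
        have hjk : j ≠ k := fun h => hk (h ▸ hj)
        rw [if_neg hjk]
    obtain ⟨w, hw, h3⟩ := cancel_prod_pow (f := fun j i => if j = k then N else e j i - N) H hK
      (fun j _ i => by have := hN j i; split_ifs <;> omega) hcb h2
    refine ⟨w k, hw k, ?_⟩
    have h4 : BoundedCombination x J e fun i => (∏ j ∈ K, x j ^ (e j i - N)) •
        ∑ j ∈ J.erase k, x j ^ (if j ∈ K then N else e j i) • w j i := by
      simp only [Finset.smul_sum]
      refine BoundedCombination.sum fun j hj => ?_
      have hjJ := Finset.mem_of_mem_erase hj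
      by_cases hjK : j ∈ K
      · convert BoundedCombination.single (x := x) (e := e) hjJ ((hw j).smul fun i =>
          ∏ l ∈ K.erase j, x l ^ (e l i - N)) using 2 with i
        rw [← Finset.mul_prod_erase K _ hjK, smul_smul, smul_smul, if_pos hjK]
        congr 1
        rw [mul_right_comm, ← pow_add, Nat.sub_add_cancel (hN j i)]
      · convert BoundedCombination.single (x := x) (e := e) hjJ ((hw j).smul fun i =>
          ∏ l ∈ K, x l ^ (e l i - N)) using 2 with i
        rw [smul_comm, if_neg hjK]
    convert hc.add h4 using 2 with i
    have h5 : c i = x k ^ (e k i - N) • w k i +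
        ∑ j ∈ J.erase k, x j ^ (if j ∈ K then N else e j i) • w j i := by
      rw [h3 i, ← Finset.add_sum_erase _ _ hkJ]
      congr 1
      · simp
      · refine Finset.sum_congr rfl fun j hj => ?_
        have hjk := Finset.ne_of_mem_erase hj
        congr 2
        by_cases hjK : j ∈ K
        · simp [hjK, hjk, Nat.sub_sub_self (hN j i)]
        · simp [hjK, hjk]
    rw [Finset.prod_insert hk]
    conv_rhs => rw [h5]
    rw [smul_add, smul_smul, mul_comm (x k ^ _)]
    abel

end UniformColon

lemma BoundedlyIntegral.exists_common {R Ω κ σ : Type*} [CommRing R] [Field Ω] [Algebra R Ω]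
    {s : Finset σ} {w : σ → κ → Ω} (hw : ∀ j ∈ s, BoundedlyIntegral R (w j)) :
    ∃ T : Submodule R Ω, T.FG ∧ T ≤ Subalgebra.toSubmodule (integralClosure R Ω) ∧
      ∀ j ∈ s, ∀ i, w j i ∈ T := by
  classical
  induction s using Finset.induction_on with
  | empty => exact ⟨⊥, Submodule.fg_bot, bot_le, by simp⟩
  | insert j s hj ih =>
    obtain ⟨T, hT, hT', h⟩ := ih fun k hk => hw k (Finset.mem_insert_of_mem hk)
    obtain ⟨U, hU, hU', h'⟩ := hw j (Finset.mem_insert_self j s)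
    refine ⟨T ⊔ U, hT.sup hU, sup_le hT' hU', fun k hk i => ?_⟩
    rcases Finset.mem_insert.1 hk with rfl | hk
    · exact Submodule.mem_sup_right (h' i)
    · exact Submodule.mem_sup_left (h k hk i)

lemma BoundedCombination.comp {R Ω σ κ κ' : Type*} [CommRing R] [Field Ω] [Algebra R Ω]
    {x : σ → R} {J : Finset σ} {e : σ → κ → ℕ} {u : κ → Ω} (hu : BoundedCombination x J e u)
    (g : κ' → κ) : BoundedCombination x J (fun j i => e j (g i)) fun i => u (g i) := by
  obtain ⟨w, hw, hu⟩ := hu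
  exact ⟨fun j i => w j (g i), fun j => (hw j).comp g, fun i => hu _⟩

/-- The elements `v` of `Ω` such that for some `s` the product of the `x j ^ s` multiplies `v` into
the ideal of the integral closure generated by the `x j ^ s`. -/
def limitSubmodule {R σ : Type*} (Ω : Type*) [CommRing R] [Field Ω] [Algebra R Ω] (x : σ → R)
    (J : Finset σ) : Submodule R Ω where
  carrier := {v | ∃ s : ℕ, BoundedCombination x J (fun _ (_ : Unit) => s)
    fun _ => (∏ j ∈ J, x j ^ s) • v}
  zero_mem' := ⟨0, by simpa using BoundedCombination.zero⟩
  add_mem' := by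
    rintro v w ⟨s, hv⟩ ⟨t, hw⟩
    refine ⟨s + t, ?_⟩
    have h1 := hv.prod_pow_smul fun _ _ => t
    have h2 := hw.prod_pow_smul fun _ _ => s
    simp only [add_comm t s] at h2
    convert h1.add h2 using 2
    simp only [pow_add, Finset.prod_mul_distrib, smul_add, mul_smul]
    rw [smul_comm (∏ j ∈ J, x j ^ s) (∏ j ∈ J, x j ^ t) v]
  smul_mem' := by
    rintro r v ⟨s, hv⟩
    refine ⟨s, ?_⟩
    convert hv.smul fun _ => r using 2
    rw [smul_comm]

namespace limitSubmodule

variable {R Ω σ : Type*} [CommRing R] [Field Ω] [Algebra R Ω] {x : σ → R} {J : Finset σ}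

lemma mem_of_prod_smul_eq {E : σ → ℕ} {v : Ω} {b : σ → Ω} (hb : ∀ j, b j ∈ integralClosure R Ω)
    (h : (∏ j ∈ J, x j ^ E j) • v = ∑ j ∈ J, x j ^ E j • b j) : v ∈ limitSubmodule Ω x J := by
  have h1 : BoundedCombination x J (fun j (_ : Unit) => E j) fun _ => (∏ j ∈ J, x j ^ E j) • v :=
    ⟨fun j _ => b j, fun j => .const (hb j), fun _ => h⟩
  refine ⟨∑ j ∈ J, E j, ?_⟩
  have hE : ∀ j ∈ J, E j + (∑ j ∈ J, E j - E j) = ∑ j ∈ J, E j := fun j hj =>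
    Nat.add_sub_cancel' (Finset.single_le_sum (fun _ _ => Nat.zero_le _) hj)
  have h2 := (h1.prod_pow_smul fun j _ => ∑ j ∈ J, E j - E j).congr_exponents
    (e' := fun _ _ => ∑ j ∈ J, E j) fun j hj => by simp only [hE j hj]
  convert h2 using 2
  rw [smul_smul, ← Finset.prod_mul_distrib]
  congr 1
  refine Finset.prod_congr rfl fun j hj => ?_
  rw [← pow_add, add_comm, hE j hj]

lemma mem_of_mem_integralClosure (hJ : J.Nonempty) {b : Ω} (hb : b ∈ integralClosure R Ω) :
    b ∈ limitSubmodule Ω x J := by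
  obtain ⟨j, hj⟩ := hJ
  refine ⟨0, ?_⟩
  simpa using BoundedCombination.single (x := x) (e := fun _ _ => 0) hj
    (.const (κ := Unit) hb)

/-- Finitely generated submodules of `limitSubmodule` satisfy the defining condition uniformly. -/
lemma exists_uniform {W : Submodule R Ω} (hW : W.FG) (hWV : W ≤ limitSubmodule Ω x J) :
    ∃ s : ℕ, BoundedCombination x J (fun _ (_ : W) => s)
      fun t : W => (∏ j ∈ J, x j ^ s) • (t : Ω) := by
  induction W, hW using Submodule.fg_induction with
  | singleton v =>
    obtain ⟨s, hs⟩ := hWV (Submodule.mem_span_singleton_self v)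
    refine ⟨s, ?_⟩
    have h : ∀ t : (R ∙ v : Submodule R Ω), ∃ r : R, r • v = t := fun t =>
      Submodule.mem_span_singleton.1 t.2
    choose r hr using h
    convert (hs.comp fun _ : (R ∙ v : Submodule R Ω) => ()).smul r using 2 with t
    rw [← hr t, smul_comm]
  | sup W₁ W₂ h₁ h₂ ih₁ ih₂ =>
    obtain ⟨s, hs⟩ := ih₁ (le_sup_left.trans hWV)
    obtain ⟨t, ht⟩ := ih₂ (le_sup_right.trans hWV)
    have h : ∀ z : (W₁ ⊔ W₂ : Submodule R Ω), ∃ (a : W₁) (b : W₂), (a : Ω) + b = z := by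
      rintro ⟨z, hz⟩
      obtain ⟨a, ha, b, hb, rfl⟩ := Submodule.mem_sup.1 hz
      exact ⟨⟨a, ha⟩, ⟨b, hb⟩, rfl⟩
    choose a b hab using h
    refine ⟨s + t, ?_⟩
    have h1 := (hs.comp a).prod_pow_smul fun _ _ => t
    have h2 := (ht.comp b).prod_pow_smul fun _ _ => s
    simp only [add_comm t s] at h2
    convert h1.add h2 using 2 with z
    rw [← hab z]
    simp only [pow_add, Finset.prod_mul_distrib, smul_add, mul_smul]
    rw [smul_comm (∏ j ∈ J, x j ^ s) (∏ j ∈ J, x j ^ t) (a z : Ω)]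

end limitSubmodule

section Equation

variable {R Ω : Type*} [CommRing R] [Field Ω] [Algebra R Ω]

open Polynomial in
/-- Monic additive equations with coefficients in the integral closure are solvable there. -/
lemma exists_mem_integralClosure_pow_sub_sum_eq [IsAlgClosed Ω] {p : ℕ} (hp : 1 < p) (n : ℕ)
    (r : ℕ → R) (b : Ω) (hb : b ∈ integralClosure R Ω) :
    (∃ τ : Ω, τ ^ p ^ n - ∑ m ∈ Finset.range n, r m • τ ^ p ^ m = b) ∧
    ∀ τ : Ω, τ ^ p ^ n - ∑ m ∈ Finset.range n, r m • τ ^ p ^ m = b → τ ∈ integralClosure R Ω := by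
  let B := integralClosure R Ω
  let P : B[X] := X ^ p ^ n - (∑ m ∈ Finset.range n, C (algebraMap R B (r m)) * X ^ p ^ m +
    C ⟨b, hb⟩)
  have hdeg : (-(∑ m ∈ Finset.range n, C (algebraMap R B (r m)) * X ^ p ^ m +
      C (⟨b, hb⟩ : B))).degree < ((p ^ n : ℕ) : WithBot ℕ) := by
    rw [degree_neg]
    refine (degree_add_le _ _).trans_lt (max_lt ?_ ?_)
    · rw [degree_lt_iff_coeff_zero]
      intro k hk
      rw [finsetSum_coeff]
      refine Finset.sum_eq_zero fun m hm => ?_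
      rw [coeff_C_mul_X_pow, if_neg]
      have := Nat.pow_lt_pow_right hp (Finset.mem_range.1 hm)
      omega
    · refine degree_C_le.trans_lt ?_
      exact_mod_cast pow_pos (by omega : 0 < p) n
  have hPeq : P = X ^ p ^ n + -(∑ m ∈ Finset.range n, C (algebraMap R B (r m)) * X ^ p ^ m +
      C ⟨b, hb⟩) := sub_eq_add_neg _ _
  have hP : P.Monic := hPeq ▸ monic_X_pow_add hdeg
  have hev : ∀ τ : Ω, eval₂ (algebraMap B Ω) τ P =
      τ ^ p ^ n - ∑ m ∈ Finset.range n, r m • τ ^ p ^ m - b := by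
    intro τ
    simp only [P, eval₂_sub, eval₂_add, eval₂_finsetSum, eval₂_mul, eval₂_C, eval₂_X_pow]
    rw [← sub_sub]
    congr 2
    refine Finset.sum_congr rfl fun m _ => ?_
    rw [Algebra.smul_def]
    rfl
  constructor
  · obtain ⟨τ, hτ⟩ := IsAlgClosed.exists_root (P.map (algebraMap B Ω)) (by
      rw [hP.degree_map]
      have : P.degree = ((p ^ n : ℕ) : WithBot ℕ) := by
        rw [hPeq, degree_add_eq_left_of_degree_lt (by rwa [degree_X_pow]), degree_X_pow]
      rw [this]
      exact_mod_cast (pow_pos (by omega : 0 < p) n).ne')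
    refine ⟨τ, ?_⟩
    rw [IsRoot, Polynomial.eval_map, hev] at hτ
    exact sub_eq_zero.1 hτ
  · intro τ hτ
    have h1 : IsIntegral B τ := ⟨P, hP, by rw [hev, hτ, sub_self]⟩
    exact isIntegral_trans (R := R) τ h1

lemma limitSubmodule.mem_of_additive_equation [IsAlgClosed Ω] {p : ℕ} [Fact p.Prime] [CharP Ω p]
    {σ : Type*} {x : σ → R} {J : Finset σ} (hJ : J.Nonempty)
    (hx : ∀ j, algebraMap R Ω (x j) ≠ 0) (n : ℕ) (r : ℕ → R) {α : Ω}
    (h : α ^ p ^ n - ∑ m ∈ Finset.range n, r m • α ^ p ^ m ∈ limitSubmodule Ω x J) :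
    α ∈ limitSubmodule Ω x J := by
  classical
  have hp : 1 < p := (Fact.out : p.Prime).one_lt
  obtain ⟨s, w, hw, h⟩ := h
  let g : Ω →+ Ω :=
    { toFun := fun z => z ^ p ^ n - ∑ m ∈ Finset.range n, r m • z ^ p ^ m
      map_zero' := by
        have h0 : ∀ k : ℕ, (0 : Ω) ^ p ^ k = 0 := fun k =>
          zero_pow (pow_pos (by omega : 0 < p) k).ne'
        simp [h0]
      map_add' := fun a b => by
        have hadd : ∀ k : ℕ, (a + b) ^ p ^ k = a ^ p ^ k + b ^ p ^ k := fun k =>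
          add_pow_char_pow (p := p) ..
        simp only [hadd, smul_add, Finset.sum_add_distrib]
        ring }
  have hy : ∀ y : R, algebraMap R Ω y ≠ 0 → ∀ b ∈ integralClosure R Ω,
      ∃ β : Ω, y • β ∈ integralClosure R Ω ∧ y • g β = b := by
    intro y hy b hb
    have hb' : y ^ (p ^ n - 1) • b ∈ integralClosure R Ω := Subalgebra.smul_mem _ hb _
    obtain ⟨⟨τ, hτ⟩, hroot⟩ := exists_mem_integralClosure_pow_sub_sum_eq hp n
      (fun m => r m * y ^ (p ^ n - p ^ m)) _ hb'
    refine ⟨(algebraMap R Ω y)⁻¹ * τ, ?_, ?_⟩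
    · rw [Algebra.smul_def, mul_inv_cancel_left₀ hy]
      exact hroot τ hτ
    · have hQ : 0 < p ^ n := pow_pos (by omega) n
      have h1 : (algebraMap R Ω y) ^ p ^ n * g ((algebraMap R Ω y)⁻¹ * τ) =
          algebraMap R Ω y ^ (p ^ n - 1) * b := by
        rw [← map_pow _ _ (p ^ n - 1), ← Algebra.smul_def (y ^ (p ^ n - 1)), ← hτ]
        simp only [g, AddMonoidHom.coe_mk, ZeroHom.coe_mk, mul_sub, Finset.mul_sum, mul_pow,
          map_pow,
          Algebra.smul_def, map_mul]
        rw [← mul_assoc, inv_pow, mul_inv_cancel₀ (pow_ne_zero _ hy), one_mul]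
        congr 1
        refine Finset.sum_congr rfl fun m hm => ?_
        have hle : p ^ m ≤ p ^ n := Nat.pow_le_pow_right (by omega) (Finset.mem_range.1 hm).le
        rw [← Nat.sub_add_cancel hle, pow_add, Nat.add_sub_cancel]
        have hym : algebraMap R Ω y ^ p ^ m ≠ 0 := pow_ne_zero _ hy
        rw [inv_pow]
        field_simp
      rw [Algebra.smul_def]
      refine mul_left_cancel₀ (pow_ne_zero (p ^ n - 1) hy) ?_
      rw [← h1, ← mul_assoc, ← pow_succ, Nat.sub_add_cancel hQ]
  have hne : ∀ K : Finset σ, algebraMap R Ω (∏ j ∈ K, x j ^ s) ≠ 0 := fun K => by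
    rw [map_prod]
    exact Finset.prod_ne_zero_iff.2 fun j _ => by rw [map_pow]; exact pow_ne_zero _ (hx j)
  choose β hβ hgβ using fun j => hy _ (hne (J.erase j)) _ ((hw j).mem ())
  have hγ : α - ∑ j ∈ J, β j ∈ integralClosure R Ω := by
    refine (exists_mem_integralClosure_pow_sub_sum_eq hp n r 0 (Subalgebra.zero_mem _)).2 _ ?_
    change g (α - ∑ j ∈ J, β j) = 0
    refine (mul_eq_zero.1 (?_ : algebraMap R Ω (∏ j ∈ J, x j ^ s) * _ = 0)).resolve_left (hne J)
    have h2 : (∏ j ∈ J, x j ^ s) • g α = ∑ j ∈ J, x j ^ s • w j () := h ()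
    rw [← Algebra.smul_def, map_sub, map_sum, smul_sub, h2, sub_eq_zero, Finset.smul_sum]
    refine Finset.sum_congr rfl fun j hj => ?_
    rw [← hgβ j, smul_smul, Finset.mul_prod_erase J (fun j => x j ^ s) hj]
  have h3 : ∑ j ∈ J, β j ∈ limitSubmodule Ω x J := by
    refine Submodule.sum_mem _ fun j hj => ⟨s, ?_⟩
    convert BoundedCombination.single (x := x) (e := fun _ _ => s) hj
      (.const (κ := Unit) (hβ j)) using 2
    rw [smul_smul, Finset.mul_prod_erase J (fun j => x j ^ s) hj]
  have := add_mem (mem_of_mem_integralClosure (x := x) hJ hγ) h3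
  rwa [sub_add_cancel] at this

end Equation

section Factorization

variable {R Ω σ : Type*} [CommRing R] [Field Ω] [Algebra R Ω]

/-- Powers of the `x j` factor the inclusion of every finitely generated submodule of the integral
closure through a finite free module. -/
def FactorsThroughFree (Ω : Type*) [Field Ω] [Algebra R Ω] (x : σ → R) : Prop :=
  ∀ T : Submodule R Ω, T.FG → T ≤ Subalgebra.toSubmodule (integralClosure R Ω) →
    ∃ N : ℕ, ∀ j, ∃ (r : ℕ) (φ : T →ₗ[R] (Fin r → R)) (ψ : Fin r → Ω),
      (∀ k, ψ k ∈ integralClosure R Ω) ∧ ∀ b : T, x j ^ N • (b : Ω) = ∑ k, φ b k • ψ k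

/-- Powers of the `x j` form permutable regular sequences. -/
def PowersColon (x : σ → R) : Prop :=
  ∀ (J : Finset σ) (l : σ), l ∉ J → ∀ (e : σ → ℕ) (s : ℕ) (a : R) (w : σ → R),
    x l ^ s * a = ∑ j ∈ J, x j ^ e j * w j → ∃ w' : σ → R, a = ∑ j ∈ J, x j ^ e j * w' j

lemma FactorsThroughFree.exists_boundedCombination {x : σ → R} (hF : FactorsThroughFree Ω x)
    (hR : PowersColon x) {T : Submodule R Ω} (hT : T.FG)
    (hT' : T ≤ Subalgebra.toSubmodule (integralClosure R Ω)) :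
    ∃ N : ℕ, ∀ (κ : Type) (J : Finset σ) (l : σ) (_ : l ∉ J) (e : σ → κ → ℕ) (f : κ → ℕ)
      (a : κ → Ω) (w : σ → κ → Ω), (∀ i, a i ∈ T) → (∀ j ∈ J, ∀ i, w j i ∈ T) →
      (∀ i, x l ^ f i • a i = ∑ j ∈ J, x j ^ e j i • w j i) →
      ∀ j, BoundedCombination x J e fun i => x j ^ N • a i := by
  classical
  obtain ⟨N, hN⟩ := hF T hT hT'
  refine ⟨N, fun κ J l hl e f a w ha hw h j => ?_⟩
  obtain ⟨r, φ, ψ, hψ, hφ⟩ := hN j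
  have h1 : ∀ (i : κ) (k : Fin r), ∃ w' : σ → R,
      φ ⟨a i, ha i⟩ k = ∑ j ∈ J, x j ^ e j i * w' j := by
    intro i k
    let W : σ → T := fun j => if hj : j ∈ J then ⟨w j i, hw j hj i⟩ else 0
    have h2 : x l ^ f i • (⟨a i, ha i⟩ : T) = ∑ j ∈ J, x j ^ e j i • W j := by
      refine Subtype.ext ?_
      simp only [SetLike.val_smul, AddSubmonoidClass.coe_finsetSum, h i]
      refine Finset.sum_congr rfl fun j hj => ?_
      simp [W, hj]
    have h3 := congrFun (congrArg φ h2) k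
    simp only [map_smul, map_sum, Finset.sum_apply, Pi.smul_apply, smul_eq_mul] at h3
    exact hR J l hl (fun j => e j i) (f i) _ (fun j => φ (W j) k) h3
  choose w' hw' using h1
  refine ⟨fun j i => ∑ k, w' i k j • ψ k, fun j => ?_, fun i => ?_⟩
  · exact BoundedlyIntegral.sum fun k _ => (BoundedlyIntegral.const (hψ k)).smul _
  · dsimp only
    rw [hφ ⟨a i, ha i⟩]
    simp only [hw', Finset.sum_smul, Finset.smul_sum, mul_smul]
    rw [Finset.sum_comm]

end Factorization

/-- Noetherian modules: every sequence satisfies a linear recurrence at some point. -/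
lemma exists_eq_sum_range_smul {R M : Type*} [CommRing R] [AddCommGroup M] [Module R M]
    [IsNoetherian R M] (c : ℕ → M) :
    ∃ (n : ℕ) (r : ℕ → R), c n = ∑ m ∈ Finset.range n, r m • c m := by
  classical
  obtain ⟨n, hn⟩ := monotone_stabilizes_iff_noetherian.2 (inferInstance : IsNoetherian R M)
    ⟨fun n => Submodule.span R (c '' (Finset.range n : Set ℕ)), fun m n hmn =>
      Submodule.span_mono (Set.image_mono (by simpa using hmn))⟩
  have h : c n ∈ Submodule.span R (c '' (Finset.range n : Set ℕ)) := by
    have h1 : Submodule.span R (c '' (Finset.range n : Set ℕ)) =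
      Submodule.span R (c '' (Finset.range (n + 1) : Set ℕ)) := hn (n + 1) n.le_succ
    rw [h1]
    exact Submodule.subset_span ⟨n, by simp, rfl⟩
  obtain ⟨r, hr⟩ := (Submodule.mem_span_image_finset_iff_exists_fun R).1 h
  refine ⟨n, fun m => if h : m ∈ Finset.range n then r ⟨m, h⟩ else 0, ?_⟩
  rw [← hr, ← Finset.sum_coe_sort (Finset.range n)]
  exact Finset.sum_congr rfl fun j _ => by simp

theorem UniformColon.of_factorsThroughFree {R Ω σ : Type*} [CommRing R] [IsNoetherianRing R]
    [Field Ω] [IsAlgClosed Ω] [Algebra R Ω] {p : ℕ} [Fact p.Prime] [CharP Ω p] {x : σ → R}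
    (hx : ∀ j, algebraMap R Ω (x j) ≠ 0) (hR : PowersColon x) (hF : FactorsThroughFree Ω x)
    (J : Finset σ) : UniformColon Ω x J := by
  classical
  induction hcard : J.card using Nat.strong_induction_on generalizing J with
  | _ m ih =>
  subst hcard
  have H : ∀ J' : Finset σ, J'.card < J.card → UniformColon Ω x J' := fun J' h => ih _ h J' rfl
  rintro κ e l hl f u hu ⟨w, hw, h⟩
  rcases J.eq_empty_or_nonempty with rfl | hJ
  · refine ⟨w, hw, fun i => ?_⟩
    have h1 := h i
    simp only [Finset.sum_empty] at h1 ⊢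
    rw [Algebra.smul_def, map_pow] at h1
    exact (mul_eq_zero.1 h1).resolve_left (pow_ne_zero _ (hx l))
  -- all members of the relation lie in a finite subalgebra `S`
  obtain ⟨T₁, hT₁, hT₁', hw₁⟩ := BoundedlyIntegral.exists_common (s := J) fun j _ => hw j
  obtain ⟨T₂, hT₂, hT₂', hu₂⟩ := hu
  obtain ⟨S, hTS, hS, hS'⟩ := BoundedlyIntegral.exists_subalgebra (hT₁.sup hT₂)
    (sup_le hT₁' hT₂')
  have huS : ∀ i, u i ∈ S := fun i => hTS (Submodule.mem_sup_right (hu₂ i))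
  have hwS : ∀ j ∈ J, ∀ i, w j i ∈ S := fun j hj i => hTS (Submodule.mem_sup_left (hw₁ j hj i))
  have hu : BoundedlyIntegral R u := ⟨T₂, hT₂, hT₂', hu₂⟩
  -- Frobenius powers of the relation
  obtain ⟨N, hN⟩ := hF.exists_boundedCombination hR hS hS'
  let U : κ × ℕ → Ω := fun i => u i.1 ^ p ^ i.2
  have hUb : BoundedlyIntegral R U := ⟨_, hS, hS', fun i => pow_mem (huS i.1) _⟩
  have h1 : ∀ j, BoundedCombination x J (fun j (i : κ × ℕ) => e j i.1 * p ^ i.2)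
      fun i => x j ^ N • U i := by
    refine hN (κ × ℕ) J l hl _ (fun i => f i.1 * p ^ i.2) U (fun j i => w j i.1 ^ p ^ i.2)
      (fun i => pow_mem (huS i.1) _) (fun j hj i => pow_mem (hwS j hj i.1) _) fun i => ?_
    have h2 := congrArg (· ^ p ^ i.2) (h i.1)
    dsimp only at h2
    rw [smul_pow, ← pow_mul, sum_pow_char_pow] at h2
    rw [h2]
    exact Finset.sum_congr rfl fun j _ => by rw [smul_pow, ← pow_mul]
  -- extraction of the coefficients of the monomials
  obtain ⟨c, hcb, hc⟩ := exists_sub_prod_pow_smul (x := x) (J := J)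
    (e := fun j (i : κ × ℕ) => e j i.1 * p ^ i.2 + N) (a := fun i => (∏ j ∈ J, x j ^ N) • U i) H
    (fun j i => Nat.le_add_left _ _) (hUb.smul _) (fun j _ => by
      convert (h1 j).prod_pow_smul (fun _ _ => N) using 2
      rw [smul_comm]) subset_rfl
  simp only [Nat.add_sub_cancel] at hc
  -- the quotients of the members of `u` by the monomials
  have hprod : ∀ E : σ → ℕ, algebraMap R Ω (∏ j ∈ J, x j ^ E j) ≠ 0 := fun E => by
    rw [map_prod]
    exact Finset.prod_ne_zero_iff.2 fun j _ => by rw [map_pow]; exact pow_ne_zero _ (hx j)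
  let α : κ → Ω := fun i => (algebraMap R Ω (∏ j ∈ J, x j ^ e j i))⁻¹ * u i
  let d : κ × ℕ → Ω := fun i => (algebraMap R Ω (∏ j ∈ J, x j ^ N))⁻¹ * c i
  have hα : ∀ i n, α i ^ p ^ n - d (i, n) ∈ limitSubmodule Ω x J := by
    intro i n
    obtain ⟨b, hb, hbe⟩ := hc
    refine limitSubmodule.mem_of_prod_smul_eq (E := fun j => e j i * p ^ n + N)
      (b := fun j => b j (i, n)) (fun j => (hb j).mem _) ?_
    rw [← hbe (i, n)]
    simp only [pow_add, Finset.prod_mul_distrib, smul_sub, mul_smul, U, α, d]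
    congr 1
    · rw [smul_comm]
      congr 1
      rw [mul_pow, Algebra.smul_def, inv_pow, ← map_pow, ← Finset.prod_pow]
      simp only [← pow_mul]
      rw [mul_inv_cancel_left₀ (hprod fun j => e j i * p ^ n)]
    · congr 1
      rw [Algebra.smul_def, mul_inv_cancel_left₀ (hprod fun _ => N)]
  obtain ⟨T, hT, hT', hcT⟩ := hcb
  have hαV : ∀ i, α i ∈ limitSubmodule Ω x J := by
    intro i
    have : IsNoetherian R T := isNoetherian_of_fg_of_noetherian T hT
    obtain ⟨n, r, hr⟩ := exists_eq_sum_range_smul (R := R) fun n => (⟨c (i, n), hcT _⟩ : T)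
    have hr' : c (i, n) = ∑ m ∈ Finset.range n, r m • c (i, m) := by
      simpa using congrArg Subtype.val hr
    refine limitSubmodule.mem_of_additive_equation (p := p) hJ hx n r ?_
    have h2 : d (i, n) = ∑ m ∈ Finset.range n, r m • d (i, m) := by
      simp only [d, hr', Finset.mul_sum, mul_smul_comm]
    have h3 := sub_mem (hα i n) (Submodule.sum_mem (limitSubmodule Ω x J)
      (t := Finset.range n) fun m _ => Submodule.smul_mem _ (r m) (hα i m))
    convert h3 using 1
    simp only [smul_sub, Finset.sum_sub_distrib, ← h2]
    ring
  have hd : ∀ i, d (i, 0) ∈ limitSubmodule Ω x J := fun i => by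
    have := sub_mem (hαV i) (hα i 0)
    simpa using this
  -- uniform bounds
  let W : Submodule R Ω := limitSubmodule Ω x J ⊓
    T.map (LinearMap.mulLeft R (algebraMap R Ω (∏ j ∈ J, x j ^ N))⁻¹)
  have hW : W.FG := by
    have : IsNoetherian R (T.map (LinearMap.mulLeft R (algebraMap R Ω (∏ j ∈ J, x j ^ N))⁻¹)) :=
      isNoetherian_of_fg_of_noetherian _ (hT.map _)
    exact Submodule.FG.of_le (hT.map _) inf_le_right
  obtain ⟨s, hs⟩ := limitSubmodule.exists_uniform hW inf_le_left
  have h4 := (hs.comp fun i : κ => (⟨d (i, 0), hd i, c (i, 0), hcT _, rfl⟩ : W)).prod_pow_smul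
    fun _ _ => N
  have hc0 : BoundedlyIntegral R fun i : κ => c (i, 0) := ⟨T, hT, hT', fun i => hcT _⟩
  have h5 : BoundedCombination x J (fun _ _ => N) fun i : κ => c (i, 0) := by
    have h6 := cancel_prod_pow (f := fun _ _ => s) (e := fun _ _ => s + N) H subset_rfl
      (fun j _ i => Nat.le_add_right _ _) hc0 (by
        convert h4 using 2 with i
        simp only [d]
        rw [smul_comm]
        congr 1
        rw [Algebra.smul_def, mul_inv_cancel_left₀ (hprod fun _ => N)])
    refine h6.congr_exponents fun j hj => ?_
    funext i
    simp [hj]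
  have h7 := h5.prod_pow_smul e
  have h8 := hc.comp fun i : κ => (i, 0)
  simp only [pow_zero, mul_one, U, pow_one] at h8
  simp only [add_comm N] at h7
  have h9 := h8.add h7
  simp only [sub_add_cancel] at h9
  refine (cancel_prod_pow (f := fun _ _ => N) H subset_rfl (fun j _ i => Nat.le_add_left _ _) hu
    h9).congr_exponents fun j hj => ?_
  funext i
  simp [hj]

section LocalFlatness

variable {R : Type} [CommRing R]

/-- Equational form of flatness of the localization of `Z` at `Q`. -/
def LocallyFlatAt (Q : Ideal R) (Z : Type) [AddCommGroup Z] [Module R Z] : Prop :=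
  ∀ (ι : Type) [Fintype ι] (z : ι → Z), ∃ c ∉ Q, ∃ (κ : Type) (_ : Fintype κ) (B : ι → κ → R)
    (y : κ → Z), (∀ a : ι → R, ∑ t, a t • z t = 0 → ∀ j, ∑ t, a t * B t j = 0) ∧
      ∀ t, c • z t = ∑ j, B t j • y j

/-- The first syzygy module of `Z` for the tautological presentation. -/
noncomputable abbrev Syzygy (R Z : Type) [CommRing R] [AddCommGroup Z] [Module R Z] :
    Submodule R (Z →₀ R) :=
  LinearMap.ker (Finsupp.linearCombination R (id : Z → Z))

/-- Vanishing of the first Tor module of `Z` and `R ⧸ I`. -/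
def SyzygyPure (I : Ideal R) (Z : Type) [AddCommGroup Z] [Module R Z] : Prop :=
  ∀ f ∈ Syzygy R Z, (∀ z, f z ∈ I) → f ∈ I • Syzygy R Z

/-- All `x l` with `l ∉ J` act injectively modulo the `x j` with `j ∈ J`. -/
def PermutablyRegular {σ : Type*} (x : σ → R) (Z : Type) [AddCommGroup Z] [Module R Z] : Prop :=
  ∀ (J : Finset σ) (l : σ), l ∉ J → ∀ z : Z,
    x l • z ∈ Ideal.span (x '' (J : Set σ)) • (⊤ : Submodule R Z) →
      z ∈ Ideal.span (x '' (J : Set σ)) • (⊤ : Submodule R Z)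

lemma Finsupp.mem_ideal_smul_top {Z : Type*} {I : Ideal R} {f : Z →₀ R} :
    f ∈ I • (⊤ : Submodule R (Z →₀ R)) ↔ ∀ z, f z ∈ I := by
  constructor
  · intro hf z
    induction hf using Submodule.smul_induction_on' with
    | smul r hr n hn => exact I.mul_mem_right _ hr
    | add f _ g _ hf hg => exact add_mem hf hg
  · intro hf
    rw [← Finsupp.sum_single f]
    refine Submodule.sum_mem _ fun z _ => ?_
    have h : Finsupp.single z (f z) = f z • Finsupp.single z (1 : R) := by simp
    rw [h]
    exact Submodule.smul_mem_smul (hf z) trivial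

lemma Submodule.exists_smul_eq_of_mem_span_singleton_smul {M : Type*} [AddCommGroup M] [Module R M]
    {a : R} {N : Submodule R M} {g : M} (hg : g ∈ Ideal.span {a} • N) : ∃ n ∈ N, a • n = g := by
  rwa [Submodule.ideal_span_singleton_smul, Submodule.mem_smul_pointwise_iff_exists] at hg

lemma Finsupp.linearCombination_mem_smul_top {Z : Type} [AddCommGroup Z] [Module R Z] {I : Ideal R}
    {f : Z →₀ R} (hf : ∀ z, f z ∈ I) :
    Finsupp.linearCombination R (id : Z → Z) f ∈ I • (⊤ : Submodule R Z) := by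
  have h := Submodule.mem_map_of_mem (f := Finsupp.linearCombination R (id : Z → Z))
    (Finsupp.mem_ideal_smul_top.2 hf)
  rw [Submodule.map_smul''] at h
  exact Submodule.smul_mono le_rfl le_top h

lemma Finsupp.exists_linearCombination_eq {Z : Type} [AddCommGroup Z] [Module R Z] {I : Ideal R}
    {z : Z} (hz : z ∈ I • (⊤ : Submodule R Z)) :
    ∃ f : Z →₀ R, (∀ z, f z ∈ I) ∧ Finsupp.linearCombination R (id : Z → Z) f = z := by
  have h : (⊤ : Submodule R Z) =
      Submodule.map (Finsupp.linearCombination R (id : Z → Z)) ⊤ := by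
    rw [Submodule.map_top, LinearMap.range_eq_top.2]
    exact fun z => ⟨Finsupp.single z 1, by simp⟩
  rw [h, ← Submodule.map_smul''] at hz
  obtain ⟨f, hf, rfl⟩ := hz
  exact ⟨f, Finsupp.mem_ideal_smul_top.1 hf, rfl⟩

lemma Syzygy.mem_smul_top_iff {Z : Type} [AddCommGroup Z] [Module R Z] {I : Ideal R}
    {f : Syzygy R Z} :
    f ∈ I • (⊤ : Submodule R (Syzygy R Z)) ↔ (f : Z →₀ R) ∈ I • Syzygy R Z :=
  Submodule.mem_smul_top_iff I (Syzygy R Z) f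

namespace SyzygyPure

variable {Z : Type} [AddCommGroup Z] [Module R Z] {σ : Type*} {x : σ → R}

lemma of_permutablyRegular (h : PermutablyRegular x Z) (J : Finset σ) :
    SyzygyPure (Ideal.span (x '' (J : Set σ))) Z := by
  classical
  induction J using Finset.induction_on with
  | empty =>
    intro f hf hfI
    have : f = 0 := by
      ext z
      simpa using hfI z
    rw [this]
    exact Submodule.zero_mem _
  | insert l J hl ih =>
    intro f hf hfI
    set I := Ideal.span (x '' (J : Set σ)) with hI
    have hins : Ideal.span (x '' ((insert l J : Finset σ) : Set σ)) = Ideal.span {x l} ⊔ I := by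
      rw [Finset.coe_insert, Set.image_insert_eq, Ideal.span_insert]
    rw [hins] at hfI ⊢
    have h1 := Finsupp.mem_ideal_smul_top.2 hfI
    rw [Submodule.sup_smul] at h1
    obtain ⟨g, hg, u, hu, rfl⟩ := Submodule.mem_sup.1 h1
    obtain ⟨g, -, rfl⟩ := Submodule.exists_smul_eq_of_mem_span_singleton_smul hg
    have hu' := Finsupp.mem_ideal_smul_top.1 hu
    have h2 : x l • Finsupp.linearCombination R (id : Z → Z) g ∈ I • (⊤ : Submodule R Z) := by
      have h3 : x l • Finsupp.linearCombination R (id : Z → Z) g =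
          - Finsupp.linearCombination R (id : Z → Z) u := by
        rw [LinearMap.mem_ker, map_add, map_smul] at hf
        exact eq_neg_of_add_eq_zero_left hf
      rw [h3]
      exact neg_mem (Finsupp.linearCombination_mem_smul_top hu')
    obtain ⟨i, hi, hiz⟩ := Finsupp.exists_linearCombination_eq (h J l hl _ h2)
    have hgi : g - i ∈ Syzygy R Z := by
      rw [LinearMap.mem_ker, map_sub, hiz, sub_self]
    have h4 : u + x l • i ∈ I • Syzygy R Z := by
      refine ih _ ?_ fun z => ?_
      · have := sub_mem hf (Submodule.smul_mem _ (x l) hgi)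
        convert this using 1
        rw [smul_sub]; abel
      · exact add_mem (hu' z) (Ideal.mul_mem_left _ _ (hi z))
    have h5 : x l • g + u = x l • (g - i) + (u + x l • i) := by
      rw [smul_sub]; abel
    rw [h5]
    refine add_mem (Submodule.smul_mem_smul (Submodule.mem_sup_left
      (Ideal.mem_span_singleton_self _)) hgi) (Submodule.smul_mono_left le_sup_right h4)

lemma of_mul_mem {I : Ideal R} {a : R} (h1 : SyzygyPure (I ⊔ Ideal.span {a}) Z)
    (h2 : ∀ K : Ideal R, (∀ r, r ∈ K ↔ a * r ∈ I) → SyzygyPure K Z) : SyzygyPure I Z := by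
  intro f hf hfI
  let K : Ideal R := Submodule.comap (LinearMap.mulLeft R a) I
  have hK : ∀ r, r ∈ K ↔ a * r ∈ I := fun r => Iff.rfl
  have h3 := h1 f hf fun z => Ideal.mem_sup_left (hfI z)
  rw [Submodule.sup_smul] at h3
  obtain ⟨u, hu, g, hg, rfl⟩ := Submodule.mem_sup.1 h3
  obtain ⟨g, hgZ, rfl⟩ := Submodule.exists_smul_eq_of_mem_span_singleton_smul hg
  have hu' := Finsupp.mem_ideal_smul_top.1 (Submodule.smul_mono le_rfl le_top hu)
  have h4 := h2 K hK g hgZ fun z => (hK _).2 (by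
    have := sub_mem (hfI z) (hu' z)
    simpa using this)
  refine add_mem hu ?_
  have h5 : ∀ g ∈ K • Syzygy R Z, a • g ∈ I • Syzygy R Z := by
    intro g hg
    induction hg using Submodule.smul_induction_on' with
    | smul r hr n hn =>
      rw [smul_smul]
      exact Submodule.smul_mem_smul ((hK r).1 hr) hn
    | add x _ y _ hx hy => rw [smul_add]; exact add_mem hx hy
  exact h5 g h4

lemma mem_smul_of_smul_mem {P : Ideal R} [P.IsPrime] {c : R} (hc : c ∉ P)
    (h : SyzygyPure (P ⊔ Ideal.span {c}) Z) {z : Z} (hz : c • z ∈ P • (⊤ : Submodule R Z)) :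
    z ∈ P • (⊤ : Submodule R Z) := by
  obtain ⟨u, hu, huz⟩ := Finsupp.exists_linearCombination_eq hz
  let f : Z →₀ R := Finsupp.single z 1
  have hf : Finsupp.linearCombination R (id : Z → Z) f = z := by simp [f]
  have h1 := h (c • f - u) (by rw [LinearMap.mem_ker, map_sub, map_smul, hf, huz, sub_self])
    fun y => sub_mem (Ideal.mem_sup_right (Ideal.mul_mem_right _ _
      (Ideal.mem_span_singleton_self c))) (Ideal.mem_sup_left (hu y))
  rw [Submodule.sup_smul] at h1
  obtain ⟨v, hv, g, hg, hvg⟩ := Submodule.mem_sup.1 h1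
  obtain ⟨g, hgZ, rfl⟩ := Submodule.exists_smul_eq_of_mem_span_singleton_smul hg
  have hv' := Finsupp.mem_ideal_smul_top.1 (Submodule.smul_mono le_rfl le_top hv)
  have h2 : ∀ y, (f - g) y ∈ P := by
    intro y
    have h3 : c * (f - g) y = v y + u y := by
      have := DFunLike.congr_fun hvg y
      simp only [Finsupp.coe_add, Finsupp.coe_sub, Finsupp.coe_smul, Pi.add_apply, Pi.sub_apply,
        Pi.smul_apply, smul_eq_mul] at this ⊢
      linear_combination -this
    exact ((Ideal.IsPrime.mem_or_mem ‹P.IsPrime›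
      (h3 ▸ add_mem (hv' y) (hu y))).resolve_left hc)
  have h4 := Finsupp.linearCombination_mem_smul_top h2
  rwa [map_sub, hf, LinearMap.mem_ker.1 hgZ, sub_zero] at h4

end SyzygyPure

lemma PermutablyRegular.syzygy {Z : Type} [AddCommGroup Z] [Module R Z] {σ : Type*} {x : σ → R}
    (hR : PermutablyRegular x R) (h : PermutablyRegular x Z) :
    PermutablyRegular x (Syzygy R Z) := by
  intro J l hl f hf
  rw [Syzygy.mem_smul_top_iff] at hf ⊢
  refine SyzygyPure.of_permutablyRegular h J f f.2 fun z => ?_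
  have h1 := Finsupp.mem_ideal_smul_top.1 (Submodule.smul_mono le_rfl le_top hf) z
  have h2 := hR J l hl ((f : Z →₀ R) z)
  simp only [smul_eq_mul, Ideal.mul_top] at h2
  exact h2 h1

lemma LocallyFlatAt.syzygy {Z : Type} [AddCommGroup Z] [Module R Z] {Q : Ideal R}
    (h : LocallyFlatAt Q Z) : LocallyFlatAt Q (Syzygy R Z) := by
  classical
  intro ι _ z
  let S : Finset Z := Finset.univ.biUnion fun t => (z t : Z →₀ R).support
  obtain ⟨c, hc, κ, _, B, y, hB, hy⟩ := h S fun s => (s : Z)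
  have hz : ∀ t, (z t : Z →₀ R) = ∑ s : S, Finsupp.single (s : Z) ((z t : Z →₀ R) s) := by
    intro t
    rw [Finset.sum_coe_sort S fun s => Finsupp.single s ((z t : Z →₀ R) s)]
    conv_lhs => rw [← Finsupp.sum_single (z t : Z →₀ R)]
    refine Finsupp.sum_of_support_subset _ ?_ _ fun _ _ => Finsupp.single_zero _
    exact Finset.subset_biUnion_of_mem (fun t => (z t : Z →₀ R).support) (Finset.mem_univ t)
  let w : S → Z →₀ R := fun s => c • Finsupp.single (s : Z) 1 -
    ∑ j, B s j • Finsupp.single (y j) 1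
  have hw : ∀ s, w s ∈ Syzygy R Z := fun s => by
    simp only [w, LinearMap.mem_ker, map_sub, map_sum, map_smul,
      Finsupp.linearCombination_single, id, one_smul, hy, sub_self]
  refine ⟨c, hc, S, inferInstance, fun t s => (z t : Z →₀ R) s, fun s => ⟨w s, hw s⟩, ?_, ?_⟩
  · intro a ha s
    have h1 := DFunLike.congr_fun (congrArg Subtype.val ha) (s : Z)
    simpa [Finsupp.finsetSum_apply] using h1
  · intro t
    have h2 : ∑ s : S, (z t : Z →₀ R) s • (s : Z) = 0 := by
      have := (z t).2
      rw [LinearMap.mem_ker, hz t, map_sum] at this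
      simpa using this
    have h3 := hB _ h2
    refine Subtype.ext ?_
    simp only [SetLike.val_smul, AddSubmonoidClass.coe_finsetSum, w, smul_sub, Finset.smul_sum,
      Finset.sum_sub_distrib]
    rw [Finset.sum_comm (s := Finset.univ) (t := (Finset.univ : Finset κ))]
    have h4 : ∀ j, ∑ s : S, (z t : Z →₀ R) s • B s j • Finsupp.single (y j) (1 : R) = 0 := by
      intro j
      simp only [smul_smul, ← Finset.sum_smul, h3 j, zero_smul]
    rw [Finset.sum_congr rfl fun j _ => h4 j, Finset.sum_const_zero, sub_zero]
    conv_lhs => rw [hz t]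
    rw [Finset.smul_sum]
    refine Finset.sum_congr rfl fun s _ => ?_
    rw [smul_smul, Finsupp.smul_single, Finsupp.smul_single, smul_eq_mul, smul_eq_mul, mul_one,
      mul_comm]

lemma LocallyFlatAt.exists_smul_mem {Z : Type} [AddCommGroup Z] [Module R Z] {Q : Ideal R}
    (h : LocallyFlatAt Q Z) (I : Ideal R) {f : Z →₀ R} (hf : f ∈ Syzygy R Z)
    (hfI : ∀ z, f z ∈ I) : ∃ c ∉ Q, c • f ∈ I • Syzygy R Z := by
  classical
  obtain ⟨c, hc, κ, _, B, y, hB, hy⟩ := h f.support fun s => (s : Z)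
  let w : f.support → Z →₀ R := fun s => c • Finsupp.single (s : Z) 1 -
    ∑ j, B s j • Finsupp.single (y j) 1
  have hw : ∀ s, w s ∈ Syzygy R Z := fun s => by
    simp only [w, LinearMap.mem_ker, map_sub, map_sum, map_smul,
      Finsupp.linearCombination_single, id, one_smul, hy, sub_self]
  have hz : f = ∑ s : f.support, Finsupp.single (s : Z) (f s) := by
    rw [Finset.sum_coe_sort f.support fun s => Finsupp.single s (f s)]
    exact (Finsupp.sum_single f).symm
  have h2 : ∑ s : f.support, f s • (s : Z) = 0 := by
    rw [LinearMap.mem_ker, hz, map_sum] at hf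
    simpa using hf
  have h3 := hB _ h2
  refine ⟨c, hc, ?_⟩
  have h5 : c • f = ∑ s : f.support, f s • w s := by
    simp only [w, smul_sub, Finset.smul_sum, Finset.sum_sub_distrib]
    rw [Finset.sum_comm (s := Finset.univ) (t := (Finset.univ : Finset κ))]
    have h4 : ∀ j, ∑ s : f.support, f s • B s j • Finsupp.single (y j) (1 : R) = 0 := by
      intro j
      simp only [smul_smul, ← Finset.sum_smul, h3 j, zero_smul]
    rw [Finset.sum_congr rfl fun j _ => h4 j, Finset.sum_const_zero, sub_zero]
    conv_lhs => rw [hz]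
    rw [Finset.smul_sum]
    refine Finset.sum_congr rfl fun s _ => ?_
    rw [smul_smul, Finsupp.smul_single, Finsupp.smul_single, smul_eq_mul, smul_eq_mul, mul_one,
      mul_comm]
  rw [h5]
  exact Submodule.sum_mem _ fun s _ => Submodule.smul_mem_smul (hfI _) (hw s)

open IsLocalRing in
lemma SyzygyPure.of_locallyFlatAt [IsNoetherianRing R] [IsLocalRing R] {σ : Type*} [Fintype σ]
    {x : σ → R} (hx : Ideal.span (Set.range x) = maximalIdeal R) (hR : PermutablyRegular x R)
    (I : Ideal R) (Z : Type) [AddCommGroup Z] [Module R Z] (hZ : PermutablyRegular x Z)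
    (hL : ∀ Q : Ideal R, Q.IsPrime → Q ≠ maximalIdeal R → LocallyFlatAt Q Z) :
    SyzygyPure I Z := by
  induction I using WellFoundedGT.induction generalizing Z with
  | ind I ih =>
  rcases eq_or_ne I ⊤ with rfl | htop
  · intro f hf _
    simpa using hf
  by_cases hmax : I = maximalIdeal R
  · have := SyzygyPure.of_permutablyRegular hZ Finset.univ
    rwa [Finset.coe_univ, Set.image_univ, hx, ← hmax] at this
  by_cases hprime : I.IsPrime
  · intro f hf hfI
    obtain ⟨c, hc, hcf⟩ := (hL I hprime hmax).exists_smul_mem I hf hfI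
    rw [← Syzygy.mem_smul_top_iff (f := ⟨f, hf⟩)]
    refine SyzygyPure.mem_smul_of_smul_mem hc (ih _ ?_ _ (hR.syzygy hZ)
      fun Q hQ hQm => (hL Q hQ hQm).syzygy) ?_
    · refine lt_of_le_of_ne le_sup_left fun h => hc ?_
      rw [h]
      exact Ideal.mem_sup_right (Ideal.mem_span_singleton_self c)
    · rwa [Syzygy.mem_smul_top_iff]
  · rw [Ideal.isPrime_iff] at hprime
    push Not at hprime
    obtain ⟨a, b, hab, ha, hb⟩ := hprime htop
    refine SyzygyPure.of_mul_mem (a := a) (ih _ ?_ _ hZ hL) fun K hK => ih K ?_ _ hZ hL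
    · refine lt_of_le_of_ne le_sup_left fun h => ha ?_
      rw [h]
      exact Ideal.mem_sup_right (Ideal.mem_span_singleton_self a)
    · refine lt_of_le_of_ne (fun r hr => (hK r).2 (I.mul_mem_left a hr)) fun h => hb ?_
      rw [h]
      exact (hK b).2 hab

lemma Module.Flat.of_syzygyPure {Z : Type} [AddCommGroup Z] [Module R Z]
    (h : ∀ I : Ideal R, SyzygyPure I Z) : Module.Flat R Z := by
  classical
  refine Module.Flat.of_forall_isTrivialRelation fun {l f x} hfx => ?_
  let e : Fin l → Z →₀ R := fun i => Finsupp.single (x i) 1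
  have he : ∀ i, Finsupp.linearCombination R (id : Z → Z) (e i) = x i := fun i => by simp [e]
  have h1 := h (Ideal.span (Set.range f)) (∑ i, f i • e i) (by
    rw [LinearMap.mem_ker, map_sum]
    simp only [map_smul, he, hfx]) fun z => by
      rw [Finsupp.finsetSum_apply]
      exact Ideal.sum_mem _ fun i _ => Ideal.mul_mem_right _ _ (Ideal.subset_span ⟨i, rfl⟩)
  obtain ⟨w, hw⟩ : ∃ w : Fin l → Syzygy R Z, ∑ i, f i • e i = ∑ i, f i • (w i : Z →₀ R) := by
    have key : ∀ g ∈ Ideal.span (Set.range f) • Syzygy R Z,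
        ∃ w : Fin l → Syzygy R Z, g = ∑ i, f i • (w i : Z →₀ R) := by
      intro g hg
      induction hg using Submodule.smul_induction_on' with
      | smul r hr n hn =>
        obtain ⟨c, rfl⟩ := Ideal.mem_span_range_iff_exists_fun.1 hr
        refine ⟨fun i => c i • ⟨n, hn⟩, ?_⟩
        simp only [Finset.sum_smul, SetLike.val_smul, smul_smul, mul_comm]
      | add x _ y _ hx hy =>
        obtain ⟨w, rfl⟩ := hx
        obtain ⟨w', rfl⟩ := hy
        exact ⟨fun i => w i + w' i, by simp [smul_add, Finset.sum_add_distrib]⟩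
    exact key _ h1
  have h2 : ∑ i, f i • (e i - (w i : Z →₀ R)) = 0 := by
    simp only [smul_sub, Finset.sum_sub_distrib, hw, sub_self]
  obtain ⟨k, a, y, hxy, ha⟩ := Module.Flat.isTrivialRelation_of_sum_smul_eq_zero h2
  refine ⟨k, a, fun j => Finsupp.linearCombination R (id : Z → Z) (y j), fun i => ?_, ha⟩
  have h3 := congrArg (Finsupp.linearCombination R (id : Z → Z)) (hxy i)
  rw [map_sub, he, LinearMap.mem_ker.1 (w i).2, sub_zero, map_sum] at h3
  simpa using h3

end LocalFlatness

section FreeFactorization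

variable {R Ω : Type} [CommRing R] [Field Ω] [Algebra R Ω]

/-- The integral closure of `R` in `Ω` is contained in a flat submodule which agrees with it
after localization at `Q`. -/
def FlatAfterLocalization (Ω : Type) [Field Ω] [Algebra R Ω] (Q : Ideal R) : Prop :=
  ∃ B' : Submodule R Ω, Module.Flat R B' ∧ Subalgebra.toSubmodule (integralClosure R Ω) ≤ B' ∧
    ∀ b ∈ B', ∃ s ∉ Q, s • b ∈ integralClosure R Ω

/-- The multipliers `c` for which the multiplication by `c` on `T` factors through a finite free
module mapping to the integral closure. -/
def freeFactorizationIdeal (T : Submodule R Ω) : Ideal R :=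
  (Submodule.span R {f : T →ₗ[R] Ω | ∃ φ : T →ₗ[R] R, ∃ b ∈ integralClosure R Ω,
    f = φ.smulRight b}).comap (LinearMap.toSpanSingleton R (T →ₗ[R] Ω) T.subtype)

lemma mem_freeFactorizationIdeal {T : Submodule R Ω} {c : R} :
    c ∈ freeFactorizationIdeal T ↔ ∃ (r : ℕ) (φ : Fin r → T →ₗ[R] R) (ψ : Fin r → Ω),
      (∀ k, ψ k ∈ integralClosure R Ω) ∧ ∀ b : T, c • (b : Ω) = ∑ k, φ k b • ψ k := by
  constructor
  · intro hc
    obtain ⟨r, a, g, hg⟩ := Submodule.mem_span_set'.1 (Submodule.mem_comap.1 hc)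
    choose φ ψ hψ hφ using fun k => (g k).2
    refine ⟨r, fun k => a k • φ k, ψ, hψ, fun b => ?_⟩
    have h := LinearMap.congr_fun hg b
    simp only [LinearMap.toSpanSingleton_apply, LinearMap.smul_apply, Submodule.subtype_apply,
      LinearMap.sum_apply] at h
    rw [← h]
    refine Finset.sum_congr rfl fun k _ => ?_
    rw [hφ k]
    simp [smul_smul]
  · rintro ⟨r, φ, ψ, hψ, h⟩
    refine Submodule.mem_comap.2 ?_
    have h' : LinearMap.toSpanSingleton R (T →ₗ[R] Ω) T.subtype c =
        ∑ k, (φ k).smulRight (ψ k) := by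
      ext b
      simp [h b]
    rw [h']
    exact Submodule.sum_mem _ fun k _ => Submodule.subset_span ⟨φ k, ψ k, hψ k, rfl⟩

lemma FlatAfterLocalization.exists_mem_freeFactorizationIdeal [IsNoetherianRing R] {Q : Ideal R}
    [Q.IsPrime] (hQ : FlatAfterLocalization Ω Q) {T : Submodule R Ω} (hT : T.FG)
    (hTB : T ≤ Subalgebra.toSubmodule (integralClosure R Ω)) :
    ∃ c ∉ Q, c ∈ freeFactorizationIdeal T := by
  obtain ⟨B', hB', hle, hs⟩ := hQ
  have := Module.Finite.iff_fg.2 hT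
  have := Module.finitePresentation_of_finite R T
  obtain ⟨k, h₂, h₃, h⟩ := Module.Flat.exists_factorization_of_finitePresentation
    (Submodule.inclusion (hTB.trans hle))
  choose s hsQ hsB using fun i : Fin k => hs _ (h₃ (Finsupp.single i 1)).2
  refine ⟨∏ i, s i, fun hmem => ?_, mem_freeFactorizationIdeal.2
    ⟨k, fun i => Finsupp.lapply i ∘ₗ h₂, fun i => (∏ i, s i) • (h₃ (Finsupp.single i 1) : Ω),
      fun i => ?_, fun b => ?_⟩⟩
  · obtain ⟨i, _, hi⟩ := (Ideal.IsPrime.prod_mem_iff).1 hmem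
    exact hsQ i hi
  · rw [← Finset.mul_prod_erase Finset.univ s (Finset.mem_univ i), mul_comm]
    beta_reduce
    rw [mul_smul]
    exact Subalgebra.smul_mem _ (hsB i) _
  · have hb : (b : Ω) = ∑ i, h₂ b i • (h₃ (Finsupp.single i 1) : Ω) := by
      have h1 : (b : Ω) = (h₃ (h₂ b) : Ω) := congrArg Subtype.val (LinearMap.congr_fun h b)
      conv_lhs => rw [h1, ← Finsupp.univ_sum_single (h₂ b)]
      rw [map_sum, Submodule.coe_sum]
      refine Finset.sum_congr rfl fun i _ => ?_
      rw [← Submodule.coe_smul, ← map_smul, Finsupp.smul_single, smul_eq_mul, mul_one]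
    conv_lhs => rw [hb]
    rw [Finset.smul_sum]
    refine Finset.sum_congr rfl fun i _ => ?_
    simp only [LinearMap.comp_apply, Finsupp.lapply_apply]
    rw [smul_comm]

lemma FlatAfterLocalization.locallyFlatAt [IsNoetherianRing R] {Q : Ideal R} [Q.IsPrime]
    (hQ : FlatAfterLocalization Ω Q) : LocallyFlatAt Q (integralClosure R Ω) := by
  intro ι _ z
  obtain ⟨c, hc, hmem⟩ := hQ.exists_mem_freeFactorizationIdeal
    (T := Submodule.span R (Set.range fun t => (z t : Ω)))
    (Submodule.fg_span (Set.finite_range _)) (Submodule.span_le.2 (by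
      rintro _ ⟨t, rfl⟩
      exact (z t).2))
  obtain ⟨r, φ, ψ, hψ, h⟩ := mem_freeFactorizationIdeal.1 hmem
  let w : ι → Submodule.span R (Set.range fun t => (z t : Ω)) := fun t =>
    ⟨z t, Submodule.subset_span ⟨t, rfl⟩⟩
  refine ⟨c, hc, Fin r, inferInstance, fun t k => φ k (w t), fun k => ⟨ψ k, hψ k⟩,
    fun a ha k => ?_, fun t => ?_⟩
  · have hw : ∑ t, a t • w t = 0 := by
      apply Subtype.ext
      rw [Submodule.coe_sum]
      have := congrArg Subtype.val ha
      rw [AddSubmonoidClass.coe_finsetSum] at this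
      exact this
    have := congrArg (φ k) hw
    rw [map_sum, map_zero] at this
    simpa using this
  · apply Subtype.ext
    rw [AddSubmonoidClass.coe_finsetSum]
    exact h (w t)

lemma FactorsThroughFree.of_flatAfterLocalization [IsNoetherianRing R] [IsLocalRing R]
    {σ : Type*} [Fintype σ] {x : σ → R} (hx : ∀ j, x j ∈ IsLocalRing.maximalIdeal R)
    (hQ : ∀ Q : Ideal R, Q.IsPrime → Q ≠ IsLocalRing.maximalIdeal R → FlatAfterLocalization Ω Q) :
    FactorsThroughFree Ω x := by
  intro T hT hTB
  have hrad : ∀ j, ∃ n, x j ^ n ∈ freeFactorizationIdeal T := by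
    intro j
    change x j ∈ (freeFactorizationIdeal T).radical
    rw [Ideal.radical_eq_sInf, Submodule.mem_sInf]
    rintro Q ⟨hle, hprime⟩
    by_cases h : Q = IsLocalRing.maximalIdeal R
    · rw [h]
      exact hx j
    · have := hprime
      obtain ⟨c, hc, hmem⟩ := (hQ Q hprime h).exists_mem_freeFactorizationIdeal hT hTB
      exact (hc (hle hmem)).elim
  choose n hn using hrad
  refine ⟨∑ j, n j, fun j => ?_⟩
  obtain ⟨r, φ, ψ, hψ, h⟩ := mem_freeFactorizationIdeal.1
    (Ideal.pow_mem_of_pow_mem _ (hn j) (Finset.single_le_sum (f := n) (fun _ _ => Nat.zero_le _)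
      (Finset.mem_univ j)))
  exact ⟨r, LinearMap.pi φ, ψ, hψ, fun b => by simpa using h b⟩

end FreeFactorization

section FrobeniusFlat

/-- Equational form of flatness of the iterated Frobenius endomorphisms. -/
def FrobeniusFlat (p : ℕ) (R : Type) [CommRing R] : Prop :=
  ∀ (k n : ℕ) (y a : Fin n → R), ∑ j, a j * y j ^ p ^ k = 0 →
    a ∈ Submodule.span R {w : Fin n → R | ∃ c : Fin n → R, ∑ j, c j * y j = 0 ∧
      w = fun j => c j ^ p ^ k}

lemma IsLocalRing.exists_minimal_generators (R : Type) [CommRing R] [IsNoetherianRing R]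
    [IsLocalRing R] : ∃ (n : ℕ) (x : Fin n → R), Ideal.span (Set.range x) = maximalIdeal R ∧
      ∀ c : Fin n → R, ∑ j, c j * x j = 0 → ∀ j, c j ∈ maximalIdeal R := by
  classical
  have hex : ∃ n, ∃ x : Fin n → R, Ideal.span (Set.range x) = maximalIdeal R :=
    Submodule.fg_iff_exists_fin_generating_family.1 (IsNoetherian.noetherian (maximalIdeal R))
  obtain ⟨x, hx⟩ := Nat.find_spec hex
  refine ⟨Nat.find hex, x, hx, fun c hc l => ?_⟩
  by_contra hl
  have hu : IsUnit (c l) := by simpa using hl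
  obtain ⟨n, hn⟩ : ∃ n, Nat.find hex = n + 1 := ⟨Nat.find hex - 1, by have := l.2; omega⟩
  have hmin := Nat.find_min hex (m := n) (by omega)
  generalize Nat.find hex = N at x hx c hc l hl hu hn
  subst hn
  refine hmin ⟨fun j => x (l.succAbove j), le_antisymm ?_ ?_⟩
  · rw [← hx]
    refine Ideal.span_mono ?_
    rintro _ ⟨j, rfl⟩
    exact ⟨_, rfl⟩
  · rw [← hx, Ideal.span_le]
    have hmem : ∀ j, x (l.succAbove j) ∈ Ideal.span (Set.range fun j => x (l.succAbove j)) :=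
      fun j => Ideal.subset_span ⟨j, rfl⟩
    rintro _ ⟨j, rfl⟩
    rcases eq_or_ne j l with rfl | hj
    · rw [Fin.sum_univ_succAbove _ j] at hc
      have h1 : c j * x j = -∑ i, c (j.succAbove i) * x (j.succAbove i) :=
        eq_neg_of_add_eq_zero_left hc
      have h2 : c j * x j ∈ Ideal.span (Set.range fun i => x (j.succAbove i)) := by
        rw [h1]
        exact neg_mem (Ideal.sum_mem _ fun i _ => Ideal.mul_mem_left _ _ (hmem i))
      exact (Ideal.unit_mul_mem_iff_mem _ hu).1 h2
    · obtain ⟨i, rfl⟩ := Fin.exists_succAbove_eq hj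
      exact hmem i

lemma FrobeniusFlat.lechIndependent {p : ℕ} {R : Type} [CommRing R] [ExpChar R p]
    (hF : FrobeniusFlat p R) {n : ℕ} {x : Fin n → R}
    (hx : ∀ c : Fin n → R, ∑ j, c j * x j = 0 → ∀ j, c j ∈ Ideal.span (Set.range x)) (k : ℕ) :
    LechIndependent fun j => x j ^ p ^ k := by
  intro a ha j
  have h := hF k n x a ha
  have hle : Submodule.span R {w : Fin n → R | ∃ c : Fin n → R, ∑ j, c j * x j = 0 ∧
      w = fun j => c j ^ p ^ k} ≤
      Submodule.comap (LinearMap.proj j : (Fin n → R) →ₗ[R] R)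
        (Ideal.span (Set.range fun j => x j ^ p ^ k)) := by
    rw [Submodule.span_le]
    rintro _ ⟨c, hc, rfl⟩
    obtain ⟨d, hd⟩ := Ideal.mem_span_range_iff_exists_fun.1 (hx c hc j)
    change c j ^ p ^ k ∈ Ideal.span (Set.range fun j => x j ^ p ^ k)
    rw [← hd, sum_pow_char_pow]
    refine Ideal.sum_mem _ fun i _ => ?_
    rw [mul_pow]
    exact Ideal.mul_mem_left _ _ (Ideal.subset_span ⟨i, rfl⟩)
  exact hle h

lemma FrobeniusFlat.flat_of_flatAfterLocalization {p : ℕ} [Fact p.Prime] {R : Type} [CommRing R]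
    [IsNoetherianRing R] [IsLocalRing R] (hF : FrobeniusFlat p R) {Ω : Type} [Field Ω]
    [IsAlgClosed Ω] [CharP Ω p] [Algebra R Ω] [FaithfulSMul R Ω]
    (hQ : ∀ Q : Ideal R, Q.IsPrime → Q ≠ IsLocalRing.maximalIdeal R → FlatAfterLocalization Ω Q) :
    Module.Flat R (integralClosure R Ω) := by
  have hinj := FaithfulSMul.algebraMap_injective R Ω
  have : CharP R p := (algebraMap R Ω).charP hinj p
  have : ExpChar R p := .prime Fact.out
  obtain ⟨n, x, hx, hmin⟩ := IsLocalRing.exists_minimal_generators R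
  have hxm : ∀ j, x j ∈ IsLocalRing.maximalIdeal R := fun j => hx ▸ Ideal.subset_span ⟨j, rfl⟩
  have hx0 : ∀ j, algebraMap R Ω (x j) ≠ 0 := by
    intro j h
    have h0 : x j = 0 := (map_eq_zero_iff _ hinj).1 h
    have := hmin (Pi.single j 1) (by simp [Pi.single_apply, h0]) j
    rw [Pi.single_eq_same] at this
    exact (Ideal.ne_top_iff_one _).1 (IsLocalRing.maximalIdeal.isMaximal R).ne_top this
  have hcolon : PowersColon x := LechIndependent.colon_subfamily hxm fun m =>
    ⟨p ^ m, (Nat.lt_pow_self (Fact.out : p.Prime).one_lt).le,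
      hF.lechIndependent (fun c hc j => hx ▸ hmin c hc j) m⟩
  have hReg : PermutablyRegular x R := by
    intro J l hl z hz
    rw [smul_eq_mul, Ideal.mul_top] at hz ⊢
    obtain ⟨c, hc⟩ := (Submodule.mem_span_image_finset_iff_exists_fun R).1 hz
    classical
    obtain ⟨w, hw⟩ := hcolon J l hl (fun _ => 1) 1 z
      (fun j => if h : j ∈ J then c ⟨j, h⟩ else 0) (by
        rw [pow_one, ← smul_eq_mul, ← hc, ← Finset.sum_coe_sort J]
        refine Finset.sum_congr rfl fun j _ => ?_
        simp [mul_comm])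
    rw [hw]
    refine Ideal.sum_mem _ fun j hj => Ideal.mul_mem_right _ _ ?_
    rw [pow_one]
    exact Ideal.subset_span ⟨j, hj, rfl⟩
  have hfree := FactorsThroughFree.of_flatAfterLocalization hxm hQ
  have hB : PermutablyRegular x (integralClosure R Ω) := by
    intro J l hl z hz
    obtain ⟨w, hw⟩ : ∃ w : Fin n → integralClosure R Ω, x l • z = ∑ j ∈ J, x j • w j := by
      generalize x l • z = y at hz
      induction hz using Submodule.smul_induction_on' with
      | smul r hr b hb =>
        obtain ⟨c, hc⟩ := (Submodule.mem_span_image_finset_iff_exists_fun R).1 hr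
        classical
        refine ⟨fun j => if h : j ∈ J then c ⟨j, h⟩ • b else 0, ?_⟩
        rw [← hc, ← Finset.sum_coe_sort J, Finset.sum_smul]
        refine Finset.sum_congr rfl fun j _ => ?_
        simp [smul_smul, mul_comm]
      | add u _ v _ hu hv =>
        obtain ⟨w, rfl⟩ := hu
        obtain ⟨w', rfl⟩ := hv
        exact ⟨fun i => w i + w' i, by simp [smul_add, Finset.sum_add_distrib]⟩
    obtain ⟨v, hv, hz'⟩ := UniformColon.of_factorsThroughFree (p := p) hx0 hcolon hfree J Unit
      (fun _ _ => 1) l hl (fun _ => 1) (fun _ => (z : Ω)) (BoundedlyIntegral.const z.2)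
      ⟨fun j _ => w j, fun j => BoundedlyIntegral.const (w j).2, fun _ => by
        have := congrArg Subtype.val hw
        rw [AddSubmonoidClass.coe_finsetSum] at this
        simpa using this⟩
    have hzv : z = ∑ j ∈ J, x j • (⟨v j (), (hv j).mem ()⟩ : integralClosure R Ω) := by
      apply Subtype.ext
      rw [AddSubmonoidClass.coe_finsetSum]
      simpa using hz' ()
    rw [hzv]
    exact Submodule.sum_mem _ fun j hj =>
      Submodule.smul_mem_smul (Ideal.subset_span ⟨j, hj, rfl⟩) trivial
  refine Module.Flat.of_syzygyPure fun I => SyzygyPure.of_locallyFlatAt hx hReg I _ hB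
    fun Q hQp hQm => ?_
  exact (hQ Q hQp hQm).locallyFlatAt

end FrobeniusFlat

section MaximalIdealTensor

open TensorProduct IsLocalRing

variable {R : Type} [CommRing R]

lemma TensorProduct.exists_eq_sum_tmul_of_span_eq_top {M B ι : Type*} [AddCommGroup M] [Module R M]
    [AddCommGroup B] [Module R B] [Fintype ι] {g : ι → M} (hg : Submodule.span R (Set.range g) = ⊤)
    (t : M ⊗[R] B) : ∃ γ : ι → B, t = ∑ i, g i ⊗ₜ γ i := by
  induction t using TensorProduct.induction_on with
  | zero => exact ⟨0, by simp⟩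
  | tmul m b =>
    obtain ⟨c, rfl⟩ := (Submodule.mem_span_range_iff_exists_fun R).1
      (hg ▸ Submodule.mem_top : m ∈ Submodule.span R (Set.range g))
    exact ⟨fun i => c i • b, by simp [TensorProduct.sum_tmul, TensorProduct.smul_tmul]⟩
  | add s t hs ht =>
    obtain ⟨γ, rfl⟩ := hs
    obtain ⟨δ, rfl⟩ := ht
    exact ⟨γ + δ, by simp [TensorProduct.tmul_add, Finset.sum_add_distrib]⟩

variable {B : Type} [AddCommGroup B] [Module R B]

lemma Submodule.exists_eq_sum_tmul_of_inclusion_rTensor_add_eq_zero [IsNoetherianRing R]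
    {Y : Type} [AddCommGroup Y] [Module R Y] [Module.Finite R Y] (X : Submodule R Y) (y : Y)
    (t : X ⊗[R] B) (b : B)
    (h : LinearMap.rTensor B
      (Submodule.inclusion (le_sup_left : X ≤ X ⊔ Submodule.span R {y})) t +
        (⟨y, le_sup_right (a := X) (Submodule.mem_span_singleton_self y)⟩ :
          (X ⊔ Submodule.span R {y} : Submodule R Y)) ⊗ₜ b = 0) :
    ∃ (k : ℕ) (c : Fin k → R) (x : Fin k → X) (β : Fin k → B), t = ∑ j, x j ⊗ₜ β j ∧
      b = ∑ j, c j • β j ∧ ∀ j, (x j : Y) = -(c j • y) := by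
  obtain ⟨n, g, hg⟩ := Submodule.fg_iff_exists_fin_generating_family.1
    (Module.Finite.fg_top : (⊤ : Submodule R X).FG)
  obtain ⟨γ, rfl⟩ := TensorProduct.exists_eq_sum_tmul_of_span_eq_top hg t
  set X' := X ⊔ Submodule.span R {y}
  let i : X →ₗ[R] X' := Submodule.inclusion le_sup_left
  let y' : X' := ⟨y, le_sup_right (a := X) (Submodule.mem_span_singleton_self y)⟩
  let g' : Option (Fin n) → X' := fun o => o.elim y' fun l => i (g l)
  have hg' : Submodule.span R (Set.range g') = ⊤ := by
    have h1 : ∀ z : X, i z ∈ Submodule.span R (Set.range g') := by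
      intro z
      obtain ⟨c, rfl⟩ := (Submodule.mem_span_range_iff_exists_fun R).1
        (hg ▸ Submodule.mem_top : z ∈ Submodule.span R (Set.range g))
      rw [map_sum]
      refine Submodule.sum_mem _ fun l _ => ?_
      rw [map_smul]
      exact Submodule.smul_mem _ _ (Submodule.subset_span ⟨some l, rfl⟩)
    rw [eq_top_iff]
    rintro ⟨z, hz⟩ -
    obtain ⟨u, hu, v, hv, rfl⟩ := Submodule.mem_sup.1 hz
    obtain ⟨r, rfl⟩ := Submodule.mem_span_singleton.1 hv
    have : (⟨u + r • y, hz⟩ : X') = i ⟨u, hu⟩ + r • y' := rfl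
    rw [this]
    exact Submodule.add_mem _ (h1 _) (Submodule.smul_mem _ _ (Submodule.subset_span ⟨none, rfl⟩))
  obtain ⟨k, a, β, hβ, ha⟩ := TensorProduct.vanishesTrivially_of_sum_tmul_eq_zero R (m := g')
    (n := fun o : Option (Fin n) => o.elim b γ) hg' (by
      rw [map_sum] at h
      rw [Fintype.sum_option, add_comm]
      simpa [g'] using h)
  refine ⟨k, fun j => a none j, fun j => ∑ l, a (some l) j • g l, β, ?_, hβ none, fun j => ?_⟩
  · have h2 : ∀ l, γ l = ∑ j, a (some l) j • β j := fun l => hβ (some l)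
    simp_rw [h2, TensorProduct.tmul_sum, ← TensorProduct.smul_tmul, TensorProduct.sum_tmul]
    rw [Finset.sum_comm]
  · have := congrArg Subtype.val (ha j)
    rw [Fintype.sum_option] at this
    rw [eq_neg_iff_add_eq_zero, add_comm]
    simpa [g', i, y'] using this

variable [IsLocalRing R]

lemma Submodule.inclusion_rTensor_injective_of_smul_mem [IsNoetherianRing R]
    (hB : Function.Injective (LinearMap.rTensor B (maximalIdeal R).subtype))
    {Y : Type} [AddCommGroup Y] [Module R Y] [Module.Finite R Y] (X : Submodule R Y) {y : Y}
    (hyX : y ∉ X) (hy : ∀ r ∈ maximalIdeal R, r • y ∈ X) :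
    Function.Injective
      (LinearMap.rTensor B (Submodule.inclusion (le_sup_left : X ≤ X ⊔ Submodule.span R {y}))) := by
  rw [injective_iff_map_eq_zero]
  intro t ht
  obtain ⟨k, c, x, β, rfl, hβ, hx⟩ :=
    X.exists_eq_sum_tmul_of_inclusion_rTensor_add_eq_zero y t 0 (by
      rw [ht, TensorProduct.tmul_zero, add_zero])
  have hcm : ∀ j, c j ∈ maximalIdeal R := by
    intro j
    by_contra h
    have hu : IsUnit (c j) := by simpa using h
    have h1 : c j • y ∈ X := by
      rw [← neg_mem_iff, ← hx j]
      exact (x j).2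
    exact hyX ((Submodule.smul_mem_iff_of_isUnit X hu).1 h1)
  have h0 : ∑ j, (⟨c j, hcm j⟩ : maximalIdeal R) ⊗ₜ[R] β j = 0 := by
    apply hB
    rw [map_sum, map_zero]
    have : ∀ j, LinearMap.rTensor B (maximalIdeal R).subtype
        ((⟨c j, hcm j⟩ : maximalIdeal R) ⊗ₜ[R] β j) = (1 : R) ⊗ₜ (c j • β j) := by
      intro j
      rw [LinearMap.rTensor_tmul, ← TensorProduct.smul_tmul]
      simp
    simp_rw [this]
    rw [← TensorProduct.tmul_sum, ← hβ, TensorProduct.tmul_zero]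
  let f : maximalIdeal R →ₗ[R] X :=
    { toFun := fun r => ⟨(r : R) • y, hy _ r.2⟩
      map_add' := fun r s => Subtype.ext (add_smul _ _ _)
      map_smul' := fun r s => Subtype.ext (mul_smul _ _ _) }
  have h1 := congrArg (LinearMap.rTensor B f) h0
  rw [map_sum, map_zero] at h1
  rw [← neg_eq_zero, ← h1, ← Finset.sum_neg_distrib]
  refine Finset.sum_congr rfl fun j _ => ?_
  rw [LinearMap.rTensor_tmul, ← TensorProduct.neg_tmul]
  congr 1
  apply Subtype.ext
  simp [hx, f]

lemma Submodule.rTensor_subtype_injective_of_pow_smul_top_le [IsNoetherianRing R]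
    (hB : Function.Injective (LinearMap.rTensor B (maximalIdeal R).subtype))
    {Y : Type} [AddCommGroup Y] [Module R Y] [Module.Finite R Y] (N : ℕ) (X : Submodule R Y)
    (hX : maximalIdeal R ^ N • (⊤ : Submodule R Y) ≤ X) :
    Function.Injective (LinearMap.rTensor B X.subtype) := by
  induction X using WellFoundedGT.induction with
  | ind X ih =>
  by_cases hX' : X = ⊤
  · subst hX'
    exact (LinearEquiv.rTensor B (Submodule.topEquiv (R := R) (M := Y))).injective
  obtain ⟨y, hyX, hy⟩ : ∃ y, y ∉ X ∧ ∀ r ∈ maximalIdeal R, r • y ∈ X := by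
    classical
    have hex : ∃ N, maximalIdeal R ^ N • (⊤ : Submodule R Y) ≤ X := ⟨N, hX⟩
    have h1 := Nat.find_spec hex
    have h2 : Nat.find hex ≠ 0 := fun h => by
      rw [h, pow_zero, Ideal.one_eq_top, Submodule.top_smul, top_le_iff] at h1
      exact hX' h1
    obtain ⟨M, hM⟩ := Nat.exists_eq_succ_of_ne_zero h2
    obtain ⟨y, hy, hyX⟩ := Set.not_subset.1 (Nat.find_min hex (m := M) (by omega))
    refine ⟨y, hyX, fun r hr => h1 ?_⟩
    rw [hM, pow_succ', mul_smul]
    exact Submodule.smul_mem_smul hr hy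
  have hlt : X < X ⊔ Submodule.span R {y} := left_lt_sup.2 fun h =>
    hyX (h (Submodule.mem_span_singleton_self y))
  have h1 := ih _ hlt (hX.trans hlt.le)
  have h2 := Submodule.inclusion_rTensor_injective_of_smul_mem hB X hyX hy
  have h3 := h1.comp h2
  rwa [← LinearMap.coe_comp, ← LinearMap.rTensor_comp, Submodule.subtype_comp_inclusion] at h3

lemma Submodule.mem_of_rTensor_subtype_eq_tmul_one [IsNoetherianRing R] {A : Type} [CommRing A]
    [Algebra R A] (hA : Function.Injective (LinearMap.rTensor A (maximalIdeal R).subtype))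
    (hmap : (maximalIdeal R).map (algebraMap R A) ≠ ⊤) {Y : Type} [AddCommGroup Y] [Module R Y]
    [Module.Finite R Y] {N : ℕ} {W : Submodule R Y}
    (hW : maximalIdeal R ^ N • (⊤ : Submodule R Y) ≤ W) {y : Y} {t : W ⊗[R] A}
    (h : LinearMap.rTensor A W.subtype t = y ⊗ₜ 1) : y ∈ W := by
  by_contra hy
  have hinj := Submodule.rTensor_subtype_injective_of_pow_smul_top_le hA N
    (W ⊔ Submodule.span R {y}) (hW.trans le_sup_left)
  obtain ⟨k, c, x, β, -, hβ, hx⟩ :=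
    W.exists_eq_sum_tmul_of_inclusion_rTensor_add_eq_zero y t (-1 : A) (by
      apply hinj
      rw [map_zero, map_add, ← LinearMap.comp_apply, ← LinearMap.rTensor_comp,
        Submodule.subtype_comp_inclusion, h, LinearMap.rTensor_tmul, Submodule.subtype_apply,
        ← TensorProduct.tmul_add, add_neg_cancel, TensorProduct.tmul_zero])
  refine hmap ((Ideal.eq_top_iff_one _).2 (neg_mem_iff.1 ?_))
  rw [hβ]
  refine Ideal.sum_mem _ fun j _ => ?_
  rw [Algebra.smul_def]
  refine Ideal.mul_mem_right _ _ (Ideal.mem_map_of_mem _ ?_)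
  by_contra hc
  have hu : IsUnit (c j) := by simpa using hc
  have h1 : c j • y ∈ W := by
    rw [← neg_mem_iff, ← hx j]
    exact (x j).2
  exact hy ((Submodule.smul_mem_iff_of_isUnit W hu).1 h1)

end MaximalIdealTensor

section FrobeniusDescent

open TensorProduct IsLocalRing

variable {R : Type} [CommRing R] [IsNoetherianRing R]

lemma Ideal.exists_relation_add_of_sum_mul_mem_pow (I : Ideal R) {n : ℕ} (y : Fin n → R) :
    ∃ s : ℕ, ∀ (M : ℕ) (c : Fin n → R), ∑ j, c j * y j ∈ I ^ (M + s) →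
      ∃ c' d : Fin n → R, c = c' + d ∧ ∑ j, c' j * y j = 0 ∧ ∀ j, d j ∈ I ^ M := by
  let f : (Fin n → R) →ₗ[R] R := Fintype.linearCombination R y
  have hf : ∀ c, f c = ∑ j, c j * y j := fun c => by
    simp [f, Fintype.linearCombination_apply]
  obtain ⟨s, hs⟩ := I.exists_pow_inf_eq_pow_smul (LinearMap.range f)
  refine ⟨s, fun M c hc => ?_⟩
  have h1 : f c ∈ I ^ (M + s) • (⊤ : Submodule R R) ⊓ LinearMap.range f := by
    refine ⟨?_, ⟨c, rfl⟩⟩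
    rw [smul_eq_mul, Ideal.mul_top, hf]
    exact hc
  rw [hs _ (Nat.le_add_left s M), Nat.add_sub_cancel] at h1
  have h2 := Submodule.smul_mono le_rfl inf_le_right h1
  rw [LinearMap.range_eq_map, ← Submodule.map_smul''] at h2
  obtain ⟨d, hd, hdc⟩ := h2
  refine ⟨c - d, d, by simp, ?_, fun j => ?_⟩
  · rw [← hf, map_sub, hdc, sub_self]
  · have h3 := Submodule.mem_map_of_mem (f := (LinearMap.proj j : (Fin n → R) →ₗ[R] R)) hd
    rw [Submodule.map_smul''] at h3
    have h4 := Submodule.smul_mono le_rfl le_top h3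
    rwa [smul_eq_mul, Ideal.mul_top] at h4

variable [IsLocalRing R]

lemma IsLocalRing.exists_relations_mod_pow {A : Type} [AddCommGroup A] [Module R A]
    (hA : Function.Injective (LinearMap.rTensor A (maximalIdeal R).subtype)) {n : ℕ}
    (y : Fin n → R) (b : Fin n → A) (hb : ∑ j, y j • b j = 0) (N : ℕ) :
    ∃ (k : ℕ) (c : Fin k → Fin n → R) (β : Fin k → A),
      (∀ l, ∑ j, c l j * y j ∈ maximalIdeal R ^ N) ∧ ∀ j, b j = ∑ l, c l j • β l := by
  obtain ⟨r, z, hz⟩ := Submodule.fg_iff_exists_fin_generating_family.1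
    (IsNoetherian.noetherian (maximalIdeal R ^ N))
  have hle : maximalIdeal R ^ N • (⊤ : Submodule R R) ≤
      Submodule.span R (Set.range (Sum.elim y z)) := by
    rw [smul_eq_mul, Ideal.mul_top, ← hz]
    refine Submodule.span_mono ?_
    rintro _ ⟨l, rfl⟩
    exact ⟨Sum.inr l, rfl⟩
  obtain ⟨k, a, β, hβ, ha⟩ :=
    TensorProduct.vanishesTrivially_of_sum_tmul_eq_zero_of_rTensor_injective R
      (n := Sum.elim b fun _ => 0)
      (Submodule.rTensor_subtype_injective_of_pow_smul_top_le hA N _ hle) (by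
        have h : ∀ j, y j ⊗ₜ[R] b j = (1 : R) ⊗ₜ (y j • b j) := fun j => by
          rw [← TensorProduct.smul_tmul, smul_eq_mul, mul_one]
        simp only [Fintype.sum_sum_type, Sum.elim_inl, Sum.elim_inr, TensorProduct.tmul_zero,
          Finset.sum_const_zero, add_zero, h]
        rw [← TensorProduct.tmul_sum, hb, TensorProduct.tmul_zero])
  refine ⟨k, fun l j => a (Sum.inl j) l, β, fun l => ?_, fun j => hβ (Sum.inl j)⟩
  have h := ha l
  simp only [Fintype.sum_sum_type, Sum.elim_inl, Sum.elim_inr, smul_eq_mul] at h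
  rw [eq_neg_of_add_eq_zero_left h, ← hz]
  exact neg_mem (Ideal.sum_mem _ fun i _ => Ideal.mul_mem_left _ _ (Ideal.subset_span ⟨i, rfl⟩))

lemma FrobeniusFlat.of_rTensor_injective {p : ℕ} [Fact p.Prime] {Ω : Type} [Field Ω]
    [IsAlgClosed Ω] [CharP Ω p] [Algebra R Ω] [FaithfulSMul R Ω]
    (h : Function.Injective
      (LinearMap.rTensor (integralClosure R Ω) (maximalIdeal R).subtype)) :
    FrobeniusFlat p R := by
  intro k n y a hya
  have hinj := FaithfulSMul.algebraMap_injective R Ω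
  have : CharP R p := (algebraMap R Ω).charP hinj p
  have hR : ExpChar R p := .prime Fact.out
  have hΩ : ExpChar Ω p := .prime Fact.out
  have hq : 0 < p ^ k := pow_pos (Fact.out : p.Prime).pos k
  obtain ⟨s, hs⟩ := (maximalIdeal R).exists_relation_add_of_sum_mul_mem_pow y
  refine IsLocalRing.mem_of_forall_mem_sup_pow _ a fun M => ?_
  choose b' hb' using fun j => IsAlgClosed.exists_pow_nat_eq (algebraMap R Ω (a j)) hq
  have hbint : ∀ j, b' j ∈ integralClosure R Ω := fun j =>
    IsIntegral.of_pow hq (by rw [hb']; exact isIntegral_algebraMap)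
  let b : Fin n → integralClosure R Ω := fun j => ⟨b' j, hbint j⟩
  have hb : ∑ j, y j • b j = 0 := by
    apply Subtype.ext
    rw [AddSubmonoidClass.coe_finsetSum]
    change ∑ j, y j • b' j = 0
    refine eq_zero_of_pow_eq_zero (n := p ^ k) ?_
    rw [sum_pow_char_pow, ← map_zero (algebraMap R Ω), ← hya, map_sum]
    refine Finset.sum_congr rfl fun j _ => ?_
    rw [Algebra.smul_def, mul_pow, hb', map_mul, map_pow, mul_comm]
  obtain ⟨m, c, β, hc, hbc⟩ := IsLocalRing.exists_relations_mod_pow h y b hb (M + s)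
  let W : Submodule R (Fin n → R) := Submodule.span R {w | ∃ c : Fin n → R,
    ∑ j, c j * y j ∈ maximalIdeal R ^ (M + s) ∧ w = fun j => c j ^ p ^ k}
  have haW : a ∈ W := by
    have hcof : ∃ N, maximalIdeal R ^ N • (⊤ : Submodule R (Fin n → R)) ≤ W := by
      have h1 : ∀ i : Fin n, ∃ N, maximalIdeal R ^ N ≤
          W.comap (LinearMap.toSpanSingleton R (Fin n → R) (Pi.single i 1)) := by
        intro i
        refine Ideal.exists_pow_le_of_le_radical_of_fg (fun r hr => ?_)
          (IsNoetherian.noetherian _)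
        refine ⟨(M + s) * p ^ k, Submodule.subset_span ⟨Pi.single i (r ^ (M + s)), ?_, ?_⟩⟩
        · refine Ideal.sum_mem _ fun j _ => Ideal.mul_mem_right _ _ ?_
          rcases eq_or_ne j i with rfl | hj
          · rw [Pi.single_eq_same]
            exact Ideal.pow_mem_pow hr _
          · rw [Pi.single_eq_of_ne hj]
            exact zero_mem _
        · funext j
          rcases eq_or_ne j i with rfl | hj
          · simp [pow_mul]
          · rw [Pi.single_eq_of_ne hj, zero_pow hq.ne', LinearMap.toSpanSingleton_apply,
              Pi.smul_apply, Pi.single_eq_of_ne hj, smul_zero]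
      choose N hN using h1
      refine ⟨∑ i, N i, Submodule.smul_le.2 fun r hr v _ => ?_⟩
      rw [← Finset.univ_sum_single v, Finset.smul_sum]
      refine Submodule.sum_mem _ fun i _ => ?_
      have h2 : r ∈ maximalIdeal R ^ N i := Ideal.pow_le_pow_right
        (Finset.single_le_sum (f := N) (fun _ _ => Nat.zero_le _) (Finset.mem_univ i)) hr
      have h3 : r • (Pi.single i (v i) : Fin n → R) = v i • r • Pi.single i 1 := by
        rw [← Pi.single_smul, ← Pi.single_smul, ← Pi.single_smul]
        simp [mul_comm]
      rw [h3]
      exact Submodule.smul_mem _ _ (hN i h2)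
    obtain ⟨N, hN⟩ := hcof
    refine Submodule.mem_of_rTensor_subtype_eq_tmul_one h ?_ hN
      (t := ∑ l, (⟨fun j => c l j ^ p ^ k, Submodule.subset_span ⟨c l, hc l, rfl⟩⟩ : W) ⊗ₜ[R]
        (β l ^ p ^ k)) ?_
    · rw [Ne, Ideal.map_eq_top_iff _ (fun r s h => hinj (congrArg Subtype.val h))
        (algebraMap_isIntegral_iff.2 inferInstance)]
      exact (maximalIdeal.isMaximal R).ne_top
    · have hsum : ∀ (v : Fin n → R) (u : integralClosure R Ω),
          v ⊗ₜ[R] u = ∑ j, (Pi.single j 1 : Fin n → R) ⊗ₜ (v j • u) := by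
        intro v u
        conv_lhs => rw [← Finset.univ_sum_single v, TensorProduct.sum_tmul]
        refine Finset.sum_congr rfl fun j _ => ?_
        rw [← TensorProduct.smul_tmul, ← Pi.single_smul, smul_eq_mul, mul_one]
      rw [map_sum, hsum]
      simp_rw [LinearMap.rTensor_tmul, Submodule.subtype_apply]
      rw [Finset.sum_congr rfl fun l _ => hsum _ _, Finset.sum_comm]
      refine Finset.sum_congr rfl fun j _ => ?_
      rw [← TensorProduct.tmul_sum]
      congr 1
      apply Subtype.ext
      rw [AddSubmonoidClass.coe_finsetSum]
      have h4 : b' j = ∑ l, c l j • (β l : Ω) := by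
        have := congrArg Subtype.val (hbc j)
        rw [AddSubmonoidClass.coe_finsetSum] at this
        exact this
      change ∑ l, c l j ^ p ^ k • (β l : Ω) ^ p ^ k = a j • (1 : Ω)
      rw [Algebra.smul_def (a j), mul_one, ← hb' j, h4, sum_pow_char_pow]
      simp_rw [smul_pow]
  refine (Submodule.span_le.2 ?_ : W ≤ _) haW
  rintro _ ⟨c, hc, rfl⟩
  obtain ⟨c', d, rfl, hc', hd⟩ := hs M c hc
  have h5 : (fun j => (c' + d) j ^ p ^ k) = (fun j => c' j ^ p ^ k) + fun j => d j ^ p ^ k := by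
    funext j
    simp [add_pow_char_pow]
  rw [h5]
  refine add_mem (Submodule.mem_sup_left (Submodule.subset_span ⟨c', hc', rfl⟩))
    (Submodule.mem_sup_right ?_)
  rw [← Finset.univ_sum_single fun j => d j ^ p ^ k]
  refine Submodule.sum_mem _ fun j _ => ?_
  have h6 : (Pi.single j (d j ^ p ^ k) : Fin n → R) = d j ^ p ^ k • Pi.single j 1 := by
    rw [← Pi.single_smul, smul_eq_mul, mul_one]
  rw [h6]
  exact Submodule.smul_mem_smul (Ideal.pow_mem_of_mem _ (hd j) _ hq) trivial

end FrobeniusDescent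

lemma FrobeniusFlat.localization {p : ℕ} {R : Type} [CommRing R] [IsDomain R]
    (hF : FrobeniusFlat p R) (M : Submonoid R) (hM : M ≤ nonZeroDivisors R) (S : Type) [CommRing S]
    [Algebra R S] [IsLocalization M S] : FrobeniusFlat p S := by
  intro k n y a h
  obtain ⟨s, hs⟩ := IsLocalization.exist_integer_multiples_of_finite M y
  obtain ⟨t, ht⟩ := IsLocalization.exist_integer_multiples_of_finite M a
  choose y' hy using hs
  choose a' ha using ht
  have hy' : ∀ j, algebraMap R S (y' j) = algebraMap R S s * y j := fun j => by
    rw [hy, Algebra.smul_def]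
  have ha' : ∀ j, algebraMap R S (a' j) = algebraMap R S t * a j := fun j => by
    rw [ha, Algebra.smul_def]
  have hsu : IsUnit (algebraMap R S s) := IsLocalization.map_units S s
  have htu : IsUnit (algebraMap R S t) := IsLocalization.map_units S t
  have h1 : ∑ j, a' j * y' j ^ p ^ k = 0 := by
    apply IsLocalization.injective S hM
    rw [map_sum, map_zero, ← mul_zero (algebraMap R S t * algebraMap R S s ^ p ^ k), ← h,
      Finset.mul_sum]
    refine Finset.sum_congr rfl fun j _ => ?_
    rw [map_mul, map_pow, hy', ha']
    ring
  have h2 : ∀ w ∈ Submodule.span R {w : Fin n → R | ∃ c : Fin n → R, ∑ j, c j * y' j = 0 ∧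
      w = fun j => c j ^ p ^ k}, (fun j => algebraMap R S (w j)) ∈
      Submodule.span S {w : Fin n → S | ∃ c : Fin n → S, ∑ j, c j * y j = 0 ∧
        w = fun j => c j ^ p ^ k} := by
    intro w hw
    induction hw using Submodule.span_induction with
    | mem w hw =>
      obtain ⟨c, hc, rfl⟩ := hw
      refine Submodule.subset_span ⟨fun j => algebraMap R S (c j), ?_, by simp⟩
      apply hsu.mul_left_cancel
      rw [mul_zero, ← map_zero (algebraMap R S), ← hc, map_sum, Finset.mul_sum]
      refine Finset.sum_congr rfl fun j _ => ?_
      rw [map_mul, hy']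
      ring
    | zero =>
      convert Submodule.zero_mem _ using 1
      funext j
      simp
    | add u v _ _ hu hv =>
      convert Submodule.add_mem _ hu hv using 1
      funext j
      simp
    | smul r u _ hu =>
      convert Submodule.smul_mem _ (algebraMap R S r) hu using 1
      funext j
      simp
  have h3 := h2 a' (hF k n y' a' h1)
  obtain ⟨v, hv⟩ := htu.exists_left_inv
  have h4 := Submodule.smul_mem _ v h3
  convert h4 using 1
  funext j
  rw [Pi.smul_apply, smul_eq_mul, ha', ← mul_assoc, hv, one_mul]

lemma FlatAfterLocalization.of_flat {R Ω : Type} [CommRing R] [Field Ω] [Algebra R Ω] (Q : Ideal R)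
    [Q.IsPrime] (S : Type) [CommRing S] [Algebra R S] [IsLocalization.AtPrime S Q] [Algebra S Ω]
    [IsScalarTower R S Ω] (h : Module.Flat S (integralClosure S Ω)) :
    FlatAfterLocalization Ω Q := by
  refine ⟨(Subalgebra.toSubmodule (integralClosure S Ω)).restrictScalars R, ?_, ?_, ?_⟩
  · have := IsLocalization.flat S Q.primeCompl
    exact Module.Flat.trans R S (integralClosure S Ω)
  · intro b hb
    exact IsIntegral.tower_top (A := S) hb
  · intro b hb
    obtain ⟨m, hm⟩ := IsIntegral.exists_multiple_integral_of_isLocalization Q.primeCompl b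
      (show IsIntegral S b from hb)
    exact ⟨m, m.2, hm⟩

theorem FrobeniusFlat.flat_integralClosure {p : ℕ} [Fact p.Prime] {Ω : Type} [Field Ω]
    [IsAlgClosed Ω] [CharP Ω p] {R : Type} [CommRing R] [IsDomain R] [IsNoetherianRing R]
    [IsLocalRing R] (hF : FrobeniusFlat p R) [Algebra R Ω] [FaithfulSMul R Ω] :
    Module.Flat R (integralClosure R Ω) := by
  obtain ⟨d, hd⟩ : ∃ d : ℕ, ringKrullDim R < d := by
    obtain ⟨d, hd⟩ := ENat.ne_top_iff_exists.1
      (Ideal.height_ne_top (IsLocalRing.maximalIdeal.isMaximal R).ne_top)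
    refine ⟨d + 1, ?_⟩
    rw [← IsLocalRing.maximalIdeal_height_eq_ringKrullDim, ← hd]
    exact_mod_cast Nat.lt_succ_self d
  induction d generalizing R with
  | zero => exact absurd hd (by simpa using ringKrullDim_nonneg_of_nontrivial)
  | succ d ih =>
    refine hF.flat_of_flatAfterLocalization fun Q hQ hQm => ?_
    have hM := Q.primeCompl_le_nonZeroDivisors
    have hinj := FaithfulSMul.algebraMap_injective R Ω
    have hu : ∀ s : Q.primeCompl, IsUnit (algebraMap R Ω s) := fun s =>
      IsUnit.mk0 _ ((map_ne_zero_iff _ hinj).2 (nonZeroDivisors.ne_zero (hM s.2)))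
    let _ : Algebra (Localization.AtPrime Q) Ω := (IsLocalization.lift hu).toAlgebra
    have : IsScalarTower R (Localization.AtPrime Q) Ω :=
      .of_algebraMap_eq fun r => (IsLocalization.lift_eq hu r).symm
    have : FaithfulSMul (Localization.AtPrime Q) Ω := by
      rw [faithfulSMul_iff_algebraMap_injective]
      refine (IsLocalization.lift_injective_iff hu).2 fun a b => ?_
      rw [hinj.eq_iff, (IsLocalization.injective (Localization.AtPrime Q) hM).eq_iff]
    refine .of_flat Q (Localization.AtPrime Q) (ih (hF.localization Q.primeCompl hM _) ?_)
    rw [IsLocalization.AtPrime.ringKrullDim_eq_height Q]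
    have hlt : Q.height < (IsLocalRing.maximalIdeal R).height :=
      Ideal.height_strict_mono_of_isPrime_of_isPrime
        (lt_of_le_of_ne (IsLocalRing.le_maximalIdeal hQ.ne_top) hQm)
    rw [← IsLocalRing.maximalIdeal_height_eq_ringKrullDim] at hd
    obtain ⟨e, he⟩ := ENat.ne_top_iff_exists.1
      (Ideal.height_ne_top (IsLocalRing.maximalIdeal.isMaximal R).ne_top)
    obtain ⟨f, hf⟩ := ENat.ne_top_iff_exists.1 hlt.ne_top
    rw [← he] at hd hlt
    rw [← hf] at hlt ⊢
    have h1 : e < d + 1 := by exact_mod_cast hd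
    have h2 : f < e := by exact_mod_cast hlt
    have h3 : f < d := by omega
    exact_mod_cast h3

/-- `Tor_{n+1}(M, N)` vanishes iff tensoring a projective resolution of `N` with `M` is exact
in degree `n + 1`. -/
lemma subsingleton_torGrp_succ_iff {R : Type} [CommRing R] {M N : Type} [AddCommGroup M]
    [Module R M] [AddCommGroup N] [Module R N] (P : ProjectiveResolution (ModuleCat.of R N))
    (n : ℕ) :
    Subsingleton (TorGrp R (n + 1) M N) ↔
      Function.Exact (LinearMap.lTensor M (P.complex.d (n + 2) (n + 1)).hom)
        (LinearMap.lTensor M (P.complex.d (n + 1) n).hom) := by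
  rw [← ModuleCat.isZero_iff_subsingleton]
  let G := (MonoidalCategory.tensoringLeft (ModuleCat R)).obj (ModuleCat.of R M)
  refine (P.isoLeftDerivedObj G (n + 1)).isZero_iff.trans ?_
  refine (HomologicalComplex.exactAt_iff_isZero_homology _ _).symm.trans ?_
  refine (HomologicalComplex.exactAt_iff' _ (n + 2) (n + 1) n
    (by simp only [ChainComplex.prev]; rfl) (by simp)).trans ?_
  exact ShortComplex.ShortExact.moduleCat_exact_iff_function_exact _

lemma subsingleton_torGrp_succ_of_flat {R : Type} [CommRing R] {M N : Type} [AddCommGroup M]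
    [Module R M] [AddCommGroup N] [Module R N] [Module.Flat R M] (n : ℕ) :
    Subsingleton (TorGrp R (n + 1) M N) := by
  let P := projectiveResolution (ModuleCat.of R N)
  refine (subsingleton_torGrp_succ_iff P n).2 ?_
  exact Module.Flat.lTensor_exact M
    ((ShortComplex.ShortExact.moduleCat_exact_iff_function_exact _).1 (P.exact_succ n))

/-- A presentation of the residue field by a projective module that stays exact after tensoring
with `M` shows that `𝔪 ⊗ M → M` is injective. -/
lemma rTensor_maximalIdeal_injective_of_exact {R : Type*} [CommRing R] [IsLocalRing R]
    {M P₀ P₁ P₂ : Type*} [AddCommGroup M] [Module R M] [AddCommGroup P₀] [Module R P₀]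
    [AddCommGroup P₁] [Module R P₁] [AddCommGroup P₂] [Module R P₂] [Module.Projective R P₀]
    (d₂ : P₂ →ₗ[R] P₁) (d₁ : P₁ →ₗ[R] P₀) (π : P₀ →ₗ[R] IsLocalRing.ResidueField R)
    (hd : d₁ ∘ₗ d₂ = 0) (hπ : Function.Surjective π) (h₀ : Function.Exact d₁ π)
    (h : Function.Exact (LinearMap.lTensor M d₂) (LinearMap.lTensor M d₁)) :
    Function.Injective (LinearMap.rTensor M (IsLocalRing.maximalIdeal R).subtype) := by
  have hmem : ∀ x, d₁ x ∈ LinearMap.ker π := fun x => (h₀ _).2 ⟨x, rfl⟩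
  let q : P₁ →ₗ[R] LinearMap.ker π := d₁.codRestrict _ hmem
  have hqs : Function.Surjective q := by
    rintro ⟨y, hy⟩
    obtain ⟨x, hx⟩ := (h₀ y).1 hy
    exact ⟨x, Subtype.ext hx⟩
  have hqd : q ∘ₗ d₂ = 0 := by
    ext x
    exact LinearMap.congr_fun hd x
  have hsub : (LinearMap.ker π).subtype ∘ₗ q = d₁ := rfl
  have hK : ∀ x, LinearMap.lTensor M (LinearMap.ker π).subtype x = 0 → x = 0 := by
    intro x hx
    obtain ⟨y, rfl⟩ := LinearMap.lTensor_surjective M hqs x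
    rw [← LinearMap.comp_apply, ← LinearMap.lTensor_comp, hsub] at hx
    obtain ⟨z, rfl⟩ := (h y).1 hx
    rw [← LinearMap.comp_apply, ← LinearMap.lTensor_comp, hqd]
    simp
  obtain ⟨e, he⟩ := hπ 1
  obtain ⟨g, hg⟩ := Module.projective_lifting_property
    (Algebra.linearMap R (IsLocalRing.ResidueField R)) π IsLocalRing.residue_surjective
  have hg' : ∀ x, IsLocalRing.residue R (g x) = π x := fun x => LinearMap.congr_fun hg x
  let f : IsLocalRing.maximalIdeal R →ₗ[R] LinearMap.ker π :=
    ((LinearMap.toSpanSingleton R P₀ e) ∘ₗ (IsLocalRing.maximalIdeal R).subtype).codRestrict _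
      (by
        intro r
        have : IsLocalRing.residue R (r : R) = 0 := Ideal.Quotient.eq_zero_iff_mem.2 r.2
        simp [LinearMap.mem_ker, he, Algebra.smul_def, this])
  let g' : LinearMap.ker π →ₗ[R] IsLocalRing.maximalIdeal R :=
    (g ∘ₗ (LinearMap.ker π).subtype).codRestrict _ (by
        intro x
        refine Ideal.Quotient.eq_zero_iff_mem.1 ?_
        exact (hg' x).trans x.2)
  have hge : IsUnit (g e) := by
    refine IsLocalRing.residue_ne_zero_iff_isUnit _ |>.1 ?_
    rw [hg', he]
    exact one_ne_zero
  have hgf : g' ∘ₗ f = g e • LinearMap.id := by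
    ext r
    simp [g', f, mul_comm]
  have hL : ∀ u, LinearMap.lTensor M (IsLocalRing.maximalIdeal R).subtype u = 0 → u = 0 := by
    intro u hu
    have h1 : LinearMap.lTensor M f u = 0 := by
      apply hK
      rw [← LinearMap.comp_apply, ← LinearMap.lTensor_comp]
      have : (LinearMap.ker π).subtype ∘ₗ f =
        (LinearMap.toSpanSingleton R P₀ e) ∘ₗ (IsLocalRing.maximalIdeal R).subtype := rfl
      rw [this, LinearMap.lTensor_comp, LinearMap.comp_apply, hu, map_zero]
    have h2 : LinearMap.lTensor M (g' ∘ₗ f) u = 0 := by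
      rw [LinearMap.lTensor_comp, LinearMap.comp_apply, h1, map_zero]
    rw [hgf, LinearMap.lTensor_smul] at h2
    simp only [LinearMap.lTensor_id, LinearMap.smul_apply, LinearMap.id_apply] at h2
    exact (hge.smul_eq_zero).1 h2
  rw [← LinearMap.lTensor_inj_iff_rTensor_inj]
  exact (injective_iff_map_eq_zero _).2 hL

lemma rTensor_maximalIdeal_injective_of_subsingleton_torGrp {R : Type} [CommRing R]
    [IsLocalRing R] {M : Type} [AddCommGroup M] [Module R M]
    (h : Subsingleton (TorGrp R 1 M (IsLocalRing.ResidueField R))) :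
    Function.Injective (LinearMap.rTensor M (IsLocalRing.maximalIdeal R).subtype) := by
  let P := projectiveResolution (ModuleCat.of R (IsLocalRing.ResidueField R))
  have hex := (subsingleton_torGrp_succ_iff P 0).1 h
  have : Module.Projective R (P.complex.X 0) :=
    (IsProjective.iff_projective _).2 (P.projective 0)
  refine rTensor_maximalIdeal_injective_of_exact (P.complex.d 2 1).hom (P.complex.d 1 0).hom
    (P.π.f 0).hom ?_ ?_ ?_ hex
  · exact congrArg ModuleCat.Hom.hom (P.complex.d_comp_d 2 1 0)
  · exact (ModuleCat.epi_iff_surjective (P.π.f 0)).1 inferInstance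
  · exact (ShortComplex.ShortExact.moduleCat_exact_iff_function_exact _).1
      (ShortComplex.exact_of_g_is_cokernel
        (ShortComplex.mk _ _ P.complex_d_comp_π_f_zero) P.isColimitCokernelCofork)

/-- Let `(R, 𝔪)` be an excellent local domain of prime characteristic `p` with residue
field `k`. If `Tor_1^R(R⁺, k) = 0`, then `Tor_n^R(R⁺, k) = 0` for all `n ≥ 1`. -/
theorem all_betti_vanish_of_first_betti_vanishes
    (R : Type) [CommRing R] [IsDomain R] [IsNoetherianRing R] [IsLocalRing R]
    (hExc : IsExcellentRing R)
    (p : ℕ) (hp : p.Prime) [CharP R p]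
    (htor : Subsingleton (TorGrp R 1 (AbsIntClo R) (IsLocalRing.ResidueField R))) :
    ∀ n : ℕ, 1 ≤ n →
      Subsingleton (TorGrp R n (AbsIntClo R) (IsLocalRing.ResidueField R)) := by
  intro n hn
  have := Fact.mk hp
  have hinj : Function.Injective (algebraMap R (AlgebraicClosure (FractionRing R))) := by
    rw [IsScalarTower.algebraMap_eq R (FractionRing R)]
    exact (algebraMap (FractionRing R) (AlgebraicClosure (FractionRing R))).injective.comp
      (IsFractionRing.injective R (FractionRing R))
  have : FaithfulSMul R (AlgebraicClosure (FractionRing R)) :=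
    (faithfulSMul_iff_algebraMap_injective _ _).2 hinj
  have : CharP (AlgebraicClosure (FractionRing R)) p := charP_of_injective_algebraMap hinj p
  have hF : FrobeniusFlat p R := FrobeniusFlat.of_rTensor_injective
    (rTensor_maximalIdeal_injective_of_subsingleton_torGrp htor)
  have : Module.Flat R (AbsIntClo R) := hF.flat_integralClosure
  obtain ⟨m, rfl⟩ := Nat.exists_eq_add_of_le' hn
  exact subsingleton_torGrp_succ_of_flat m
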